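/- arXiv:2402.08215 — 13 statements merged into one kernel-verified Lean document; each statement's English description precedes it below -/
import Mathlib

section
/- If P is an infinite set of points in the Euclidean plane ℝ² such that the distance between any two points of P is an integer, then all points of P lie on a single line. -/
theorem EuclideanSpace.dist_sq_fin_two (X Y : EuclideanSpace ℝ (Fin 2)) :
    dist X Y ^ 2 = (X 0 - Y 0) ^ 2 + (X 1 - Y 1) ^ 2 := by
  rw [EuclideanSpace.dist_eq, Real.sq_sqrt (by positivity), Fin.sum_univ_two, Real.dist_eq,
    Real.dist_eq, sq_abs, sq_abs]

theorem finite_setOf_quadratic_eq_zero {a b c : ℝ} (h : ¬(a = 0 ∧ b = 0 ∧ c = 0)) :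
    {r : ℝ | a * r ^ 2 + b * r + c = 0}.Finite := by
  open Polynomial in
  have hp : (C a * X ^ 2 + C b * X + C c : ℝ[X]) ≠ 0 := by
    intro h0
    refine h ⟨?_, ?_, ?_⟩
    · simpa [coeff_X, coeff_C] using congrArg (fun p => coeff p 2) h0
    · simpa [coeff_X, coeff_C, coeff_X_pow] using congrArg (fun p => coeff p 1) h0
    · simpa [coeff_X, coeff_C] using congrArg (fun p => coeff p 0) h0
  refine (Polynomial.finite_setOfPred_isRoot hp).subset fun r hr => ?_
  simpa [Polynomial.IsRoot] using hr

/-- Two hyperbola branches sharing the focus `A`, with other foci `B` and `C` not aligned with `A`,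
have finitely many common points. -/
theorem finite_setOf_dist_sub_dist_eq {A B C : EuclideanSpace ℝ (Fin 2)}
    (hABC : (B 0 - A 0) * (C 1 - A 1) - (B 1 - A 1) * (C 0 - A 0) ≠ 0) (m n : ℝ) :
    {X : EuclideanSpace ℝ (Fin 2) |
      dist X A - dist X B = m ∧ dist X A - dist X C = n}.Finite := by
  set b₁ := B 0 - A 0 with hb₁
  set b₂ := B 1 - A 1 with hb₂
  set c₁ := C 0 - A 0 with hc₁
  set c₂ := C 1 - A 1 with hc₂
  set D := b₁ * c₂ - b₂ * c₁ with hD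
  set k := (b₁ ^ 2 + b₂ ^ 2 - m ^ 2) / 2 with hk
  set l := (c₁ ^ 2 + c₂ ^ 2 - n ^ 2) / 2 with hl
  set u₁ := m * c₂ - n * b₂ with hu₁
  set u₂ := n * b₁ - m * c₁ with hu₂
  set v₁ := k * c₂ - l * b₂ with hv₁
  set v₂ := l * b₁ - k * c₁ with hv₂
  have key : ∀ X : EuclideanSpace ℝ (Fin 2), dist X A - dist X B = m → dist X A - dist X C = n →
      D * (X 0 - A 0) = dist X A * u₁ + v₁ ∧ D * (X 1 - A 1) = dist X A * u₂ + v₂ := by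
    intro X hm hn
    have hA := EuclideanSpace.dist_sq_fin_two X A
    have hB := EuclideanSpace.dist_sq_fin_two X B
    have hC := EuclideanSpace.dist_sq_fin_two X C
    rw [show dist X B = dist X A - m by linarith] at hB
    rw [show dist X C = dist X A - n by linarith] at hC
    have e₁ : (X 0 - A 0) * b₁ + (X 1 - A 1) * b₂ = dist X A * m + k := by
      rw [hk, hb₁, hb₂]; linarith
    have e₂ : (X 0 - A 0) * c₁ + (X 1 - A 1) * c₂ = dist X A * n + l := by
      rw [hl, hc₁, hc₂]; linarith
    constructor
    · rw [hD, hu₁, hv₁]; linear_combination c₂ * e₁ - b₂ * e₂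
    · rw [hD, hu₂, hv₂]; linear_combination b₁ * e₂ - c₁ * e₁
  have hne : ¬(u₁ ^ 2 + u₂ ^ 2 - D ^ 2 = 0 ∧ 2 * (u₁ * v₁ + u₂ * v₂) = 0 ∧
      v₁ ^ 2 + v₂ ^ 2 = 0) := by
    rintro ⟨h₁, -, h₃⟩
    obtain ⟨hv₁0, hv₂0⟩ : v₁ = 0 ∧ v₂ = 0 := by
      simpa using (add_eq_zero_iff_of_nonneg (sq_nonneg v₁) (sq_nonneg v₂)).mp h₃
    have hk0 : k = 0 := by
      refine (mul_eq_zero.mp (?_ : D * k = 0)).resolve_left hABC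
      linear_combination b₁ * hv₁0 + b₂ * hv₂0
    have hl0 : l = 0 := by
      refine (mul_eq_zero.mp (?_ : D * l = 0)).resolve_left hABC
      linear_combination c₁ * hv₁0 + c₂ * hv₂0
    have hm : m ^ 2 = b₁ ^ 2 + b₂ ^ 2 := by linarith
    have hn : n ^ 2 = c₁ ^ 2 + c₂ ^ 2 := by linarith
    have hmn : m * n = b₁ * c₁ + b₂ * c₂ := by
      refine sub_eq_zero.mp (pow_eq_zero_iff two_ne_zero |>.mp ?_)
      rw [hu₁, hu₂, hD] at h₁
      linear_combination h₁ + (n ^ 2 - c₁ ^ 2 - c₂ ^ 2) * hm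
    refine hABC (pow_eq_zero_iff two_ne_zero |>.mp ?_)
    rw [hD]
    linear_combination (m * n + (b₁ * c₁ + b₂ * c₂)) * hmn - n ^ 2 * hm - (b₁ ^ 2 + b₂ ^ 2) * hn
  refine Set.Finite.of_finite_image (f := fun X => dist X A)
    ((finite_setOf_quadratic_eq_zero hne).subset ?_) ?_
  · rintro _ ⟨X, ⟨hm, hn⟩, rfl⟩
    obtain ⟨h₁, h₂⟩ := key X hm hn
    have hA := EuclideanSpace.dist_sq_fin_two X A
    simp only [Set.mem_ofPred_eq]
    linear_combination -(D * (X 0 - A 0) + (dist X A * u₁ + v₁)) * h₁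
      - (D * (X 1 - A 1) + (dist X A * u₂ + v₂)) * h₂ - D ^ 2 * hA
  · rintro X ⟨hm, hn⟩ Y ⟨hm', hn'⟩ (hXY : dist X A = dist Y A)
    obtain ⟨h₁, h₂⟩ := key X hm hn
    obtain ⟨h₁', h₂'⟩ := key Y hm' hn'
    rw [← hXY] at h₁' h₂'
    have e₁ := mul_left_cancel₀ hABC (h₁.trans h₁'.symm)
    have e₂ := mul_left_cancel₀ hABC (h₂.trans h₂'.symm)
    ext i
    fin_cases i
    · simpa using e₁
    · simpa using e₂

theorem collinear_of_cross_eq_zero {P : Set (EuclideanSpace ℝ (Fin 2))}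
    {A B : EuclideanSpace ℝ (Fin 2)} (hA : A ∈ P) (hAB : A ≠ B)
    (h : ∀ C ∈ P, (B 0 - A 0) * (C 1 - A 1) - (B 1 - A 1) * (C 0 - A 0) = 0) :
    Collinear ℝ P := by
  have hd : (B 0 - A 0) ^ 2 + (B 1 - A 1) ^ 2 ≠ 0 := by
    rw [← EuclideanSpace.dist_sq_fin_two]
    exact pow_ne_zero 2 (dist_ne_zero.mpr hAB.symm)
  refine (collinear_iff_of_mem hA).mpr ⟨B - A, fun C hC => ?_⟩
  have hC := h C hC
  refine ⟨((C 0 - A 0) * (B 0 - A 0) + (C 1 - A 1) * (B 1 - A 1)) /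
    ((B 0 - A 0) ^ 2 + (B 1 - A 1) ^ 2), ?_⟩
  ext i
  fin_cases i
  · simp
    field_simp
    linear_combination -(B 1 - A 1) * hC
  · simp
    field_simp
    linear_combination (B 0 - A 0) * hC

theorem anning_erdos (P : Set (EuclideanSpace ℝ (Fin 2))) (hP : P.Infinite)
    (hint : ∀ p ∈ P, ∀ q ∈ P, ∃ n : ℤ, dist p q = (n : ℝ)) :
    Collinear ℝ P := by
  obtain ⟨A, hA, B, hB, hAB⟩ := hP.nontrivial
  by_contra hcol
  obtain ⟨C, hC, hABC⟩ : ∃ C ∈ P,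
      (B 0 - A 0) * (C 1 - A 1) - (B 1 - A 1) * (C 0 - A 0) ≠ 0 := by
    by_contra! h
    exact hcol (collinear_of_cross_eq_zero hA hAB h)
  obtain ⟨M, hM⟩ := hint A hA B hB
  obtain ⟨N, hN⟩ := hint A hA C hC
  refine hP (Set.Finite.subset (((Set.finite_Icc (-M) M).prod (Set.finite_Icc (-N) N)).biUnion
    fun p _ => finite_setOf_dist_sub_dist_eq hABC (p.1 : ℝ) (p.2 : ℝ)) fun X hX => ?_)
  obtain ⟨a, ha⟩ := hint X hX A hA
  obtain ⟨b, hb⟩ := hint X hX B hB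
  obtain ⟨c, hc⟩ := hint X hX C hC
  have hbM := abs_le.mp (abs_dist_sub_le A B X)
  have hcN := abs_le.mp (abs_dist_sub_le A C X)
  rw [dist_comm A X, dist_comm B X, ha, hb, hM] at hbM
  rw [dist_comm A X, dist_comm C X, ha, hc, hN] at hcN
  refine Set.mem_biUnion (x := (a - b, a - c)) ?_ ?_
  · simp only [Set.mem_prod, Set.mem_Icc]
    exact_mod_cast And.intro hbM hcN
  · simp [ha, hb, hc]
end

section
/- Let A, B, C be three points of the Euclidean plane ℝ² that do not lie on a common line. Then the set S = {X ∈ ℝ² : dist(X,A) − dist(X,B) ∈ ℤ and dist(X,A) − dist(X,C) ∈ ℤ} is finite, and its cardinality is at most 4(⌊dist(A,B)⌋ + 1)(⌊dist(A,C)⌋ + 1). -/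
theorem exists_finset_quadratic_roots {a b c : ℝ} (h : a = 0 → c ≠ 0) :
    ∃ F : Finset ℝ, F.card ≤ 2 ∧ ∀ s : ℝ, a * s ^ 2 + b * s + c = 0 → s ∈ F := by
  classical
  let p : Polynomial ℝ :=
    Polynomial.C a * Polynomial.X ^ 2 + Polynomial.C b * Polynomial.X + Polynomial.C c
  have hp : p ≠ 0 := by
    intro hp
    have h2 : p.coeff 2 = 0 := by rw [hp, Polynomial.coeff_zero]
    have h0 : p.coeff 0 = 0 := by rw [hp, Polynomial.coeff_zero]
    have ha : a = 0 := by simpa [p, Polynomial.coeff_X, Polynomial.coeff_C] using h2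
    have hc : c = 0 := by simpa [p] using h0
    exact h ha hc
  refine ⟨p.roots.toFinset, ?_, fun s hs => ?_⟩
  · exact (Multiset.toFinset_card_le _).trans
      ((Polynomial.card_roots' p).trans Polynomial.natDegree_quadratic_le)
  · rw [Multiset.mem_toFinset, Polynomial.mem_roots hp]
    simpa [p, Polynomial.IsRoot] using hs

theorem collinear_triple_of_det_eq_zero {A B C : EuclideanSpace ℝ (Fin 2)}
    (h : (B 0 - A 0) * (C 1 - A 1) - (B 1 - A 1) * (C 0 - A 0) = 0) :
    Collinear ℝ ({A, B, C} : Set (EuclideanSpace ℝ (Fin 2))) := by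
  rw [collinear_iff_of_mem (p₀ := A) (by simp)]
  by_cases hB : B = A
  · refine ⟨C - A, fun p hp => ?_⟩
    rcases hp with rfl | rfl | rfl
    · exact ⟨0, by simp⟩
    · exact ⟨0, by simp [hB]⟩
    · exact ⟨1, by simp⟩
  · have hpos : (B 0 - A 0) ^ 2 + (B 1 - A 1) ^ 2 ≠ 0 := by
      intro h0
      apply hB
      ext i
      fin_cases i
      · have hsq : (B 0 - A 0) ^ 2 = 0 := by
          nlinarith [sq_nonneg (B 0 - A 0), sq_nonneg (B 1 - A 1)]
        exact sub_eq_zero.1 (by simpa using hsq)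
      · have hsq : (B 1 - A 1) ^ 2 = 0 := by
          nlinarith [sq_nonneg (B 0 - A 0), sq_nonneg (B 1 - A 1)]
        exact sub_eq_zero.1 (by simpa using hsq)
    refine ⟨B - A, fun p hp => ?_⟩
    rcases hp with rfl | rfl | rfl
    · exact ⟨0, by simp⟩
    · exact ⟨1, by simp⟩
    · refine ⟨((B 0 - A 0) * (p 0 - A 0) + (B 1 - A 1) * (p 1 - A 1)) /
        ((B 0 - A 0) ^ 2 + (B 1 - A 1) ^ 2), ?_⟩
      ext i
      fin_cases i
      · simp only [vadd_eq_add, PiLp.add_apply, PiLp.smul_apply, PiLp.sub_apply, smul_eq_mul,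
          Fin.zero_eta]
        field_simp
        linear_combination (-(B 1 - A 1)) * h
      · simp only [vadd_eq_add, PiLp.add_apply, PiLp.smul_apply, PiLp.sub_apply, smul_eq_mul,
          Fin.mk_one]
        field_simp
        linear_combination (B 0 - A 0) * h

/-- Two full hyperbolas sharing the focus `A`, with the branches coupled through a common signed
distance `s` to `A`, meet in at most two points. -/
theorem exists_finset_signed_hyperbolas {A B C : EuclideanSpace ℝ (Fin 2)}
    (hABC : ¬ Collinear ℝ ({A, B, C} : Set (EuclideanSpace ℝ (Fin 2)))) (n m : ℝ) :
    ∃ F : Finset (EuclideanSpace ℝ (Fin 2)), F.card ≤ 2 ∧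
      ∀ (X : EuclideanSpace ℝ (Fin 2)) (s : ℝ), dist X A ^ 2 = s ^ 2 →
        dist X B ^ 2 = (s - n) ^ 2 → dist X C ^ 2 = (s - m) ^ 2 → X ∈ F := by
  classical
  obtain ⟨b₀, hb₀⟩ : ∃ t, t = B 0 - A 0 := ⟨_, rfl⟩
  obtain ⟨b₁, hb₁⟩ : ∃ t, t = B 1 - A 1 := ⟨_, rfl⟩
  obtain ⟨c₀, hc₀⟩ : ∃ t, t = C 0 - A 0 := ⟨_, rfl⟩
  obtain ⟨c₁, hc₁⟩ : ∃ t, t = C 1 - A 1 := ⟨_, rfl⟩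
  obtain ⟨D, hD⟩ : ∃ t, t = b₀ * c₁ - b₁ * c₀ := ⟨_, rfl⟩
  have hD0 : D ≠ 0 := fun h0 => hABC <| collinear_triple_of_det_eq_zero <| by
    rw [← hb₀, ← hb₁, ← hc₀, ← hc₁, ← hD, h0]
  obtain ⟨u, hu⟩ : ∃ t, t = (b₀ ^ 2 + b₁ ^ 2 - n ^ 2) / 2 := ⟨_, rfl⟩
  obtain ⟨v, hv⟩ : ∃ t, t = (c₀ ^ 2 + c₁ ^ 2 - m ^ 2) / 2 := ⟨_, rfl⟩
  obtain ⟨R, hR, hmem⟩ := exists_finset_quadratic_roots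
    (a := (n * c₁ - m * b₁) ^ 2 + (b₀ * m - c₀ * n) ^ 2 - D ^ 2)
    (b := 2 * ((n * c₁ - m * b₁) * (u * c₁ - v * b₁) + (b₀ * m - c₀ * n) * (b₀ * v - c₀ * u)))
    (c := (u * c₁ - v * b₁) ^ 2 + (b₀ * v - c₀ * u) ^ 2) (by
      intro ha hc
      have h1 : u * c₁ - v * b₁ = 0 := by
        nlinarith [sq_nonneg (u * c₁ - v * b₁), sq_nonneg (b₀ * v - c₀ * u)]
      have h2 : b₀ * v - c₀ * u = 0 := by
        nlinarith [sq_nonneg (u * c₁ - v * b₁), sq_nonneg (b₀ * v - c₀ * u)]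
      have hu0 : D * u = 0 := by linear_combination u * hD + b₀ * h1 + b₁ * h2
      have hv0 : D * v = 0 := by linear_combination v * hD + c₀ * h1 + c₁ * h2
      replace hu0 := (mul_eq_zero.1 hu0).resolve_left hD0
      replace hv0 := (mul_eq_zero.1 hv0).resolve_left hD0
      have hb : b₀ ^ 2 + b₁ ^ 2 = n ^ 2 := by linarith
      have hc : c₀ ^ 2 + c₁ ^ 2 = m ^ 2 := by linarith
      have hbc : (b₀ * c₀ + b₁ * c₁ - n * m) ^ 2 = 0 := by
        rw [hD] at ha
        linear_combination ha + (c₀ ^ 2 + c₁ ^ 2 - m ^ 2) * hb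
      replace hbc : b₀ * c₀ + b₁ * c₁ - n * m = 0 := by simpa using hbc
      apply hD0
      have : D ^ 2 = 0 := by
        rw [hD]
        linear_combination (c₀ ^ 2 + c₁ ^ 2) * hb + n ^ 2 * hc
          - (b₀ * c₀ + b₁ * c₁ + n * m) * hbc
      simpa using this)
  refine ⟨R.image fun s => !₂[A 0 + ((u + s * n) * c₁ - (v + s * m) * b₁) / D,
    A 1 + (b₀ * (v + s * m) - c₀ * (u + s * n)) / D], Finset.card_image_le.trans hR, ?_⟩
  intro X s hA hB hC
  rw [EuclideanSpace.dist_sq_fin_two] at hA hB hC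
  have hXB : (X 0 - A 0) * b₀ + (X 1 - A 1) * b₁ = u + s * n := by
    rw [hu, hb₀, hb₁]
    linear_combination (hA - hB) / 2
  have hXC : (X 0 - A 0) * c₀ + (X 1 - A 1) * c₁ = v + s * m := by
    rw [hv, hc₀, hc₁]
    linear_combination (hA - hC) / 2
  have hX0 : (u + s * n) * c₁ - (v + s * m) * b₁ = D * (X 0 - A 0) := by
    rw [hD]
    linear_combination b₁ * hXC - c₁ * hXB
  have hX1 : b₀ * (v + s * m) - c₀ * (u + s * n) = D * (X 1 - A 1) := by
    rw [hD]
    linear_combination c₀ * hXB - b₀ * hXC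
  refine Finset.mem_image.2 ⟨s, hmem s ?_, ?_⟩
  · linear_combination ((u + s * n) * c₁ - (v + s * m) * b₁ + D * (X 0 - A 0)) * hX0 +
      (b₀ * (v + s * m) - c₀ * (u + s * n) + D * (X 1 - A 1)) * hX1 + D ^ 2 * hA
  · rw [hX0, hX1, mul_div_cancel_left₀ _ hD0, mul_div_cancel_left₀ _ hD0]
    ext i
    fin_cases i <;> simp

theorem hyperbola_intersection_finite (A B C : EuclideanSpace ℝ (Fin 2))
    (hABC : ¬ Collinear ℝ ({A, B, C} : Set (EuclideanSpace ℝ (Fin 2)))) :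
    {X : EuclideanSpace ℝ (Fin 2) |
        (∃ n : ℤ, dist X A - dist X B = (n : ℝ)) ∧
        (∃ m : ℤ, dist X A - dist X C = (m : ℝ))}.Finite ∧
    ({X : EuclideanSpace ℝ (Fin 2) |
        (∃ n : ℤ, dist X A - dist X B = (n : ℝ)) ∧
        (∃ m : ℤ, dist X A - dist X C = (m : ℝ))}.ncard : ℤ) ≤
      4 * (⌊dist A B⌋ + 1) * (⌊dist A C⌋ + 1) := by
  classical
  choose F hcard hF using exists_finset_signed_hyperbolas hABC
  let G : Finset (EuclideanSpace ℝ (Fin 2)) :=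
    (Finset.range (⌊dist A B⌋₊ + 1) ×ˢ Finset.range (⌊dist A C⌋₊ + 1)).biUnion
      fun q => F q.1 q.2 ∪ F q.1 (-q.2)
  have hG : G.card ≤ (⌊dist A B⌋₊ + 1) * (⌊dist A C⌋₊ + 1) * 4 := by
    refine (Finset.card_biUnion_le_card_mul _ _ 4 fun q _ => ?_).trans_eq ?_
    · exact (Finset.card_union_le _ _).trans (add_le_add (hcard _ _) (hcard _ _))
    · simp
  have natAbs_mem (X Y : EuclideanSpace ℝ (Fin 2)) (n : ℤ) (h : dist X A - dist X Y = n) :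
      n.natAbs ∈ Finset.range (⌊dist A Y⌋₊ + 1) := by
    rw [Finset.mem_range, Nat.lt_succ_iff]
    apply Nat.le_floor
    rw [Nat.cast_natAbs, Int.cast_abs, ← h, dist_comm X A, dist_comm X Y]
    exact abs_dist_sub_le A Y X
  have hsub : {X : EuclideanSpace ℝ (Fin 2) |
        (∃ n : ℤ, dist X A - dist X B = (n : ℝ)) ∧
        (∃ m : ℤ, dist X A - dist X C = (m : ℝ))} ⊆ (G : Set (EuclideanSpace ℝ (Fin 2))) := by
    rintro X ⟨⟨n, hn⟩, m, hm⟩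
    refine Finset.mem_coe.2 (Finset.mem_biUnion.2 ⟨(n.natAbs, m.natAbs),
      Finset.mem_product.2 ⟨natAbs_mem X B n hn, natAbs_mem X C m hm⟩, ?_⟩)
    have hB : dist X B = dist X A - n := by linarith
    have hC : dist X C = dist X A - m := by linarith
    have hn' : (n.natAbs : ℝ) = n ∨ (n.natAbs : ℝ) = -n := by
      rw [Nat.cast_natAbs, Int.cast_abs]
      exact abs_choice _
    have hm' : (m.natAbs : ℝ) = m ∨ (m.natAbs : ℝ) = -m := by
      rw [Nat.cast_natAbs, Int.cast_abs]
      exact abs_choice _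
    rw [Finset.mem_union]
    rcases hn' with h1 | h1 <;> rcases hm' with h2 | h2 <;> simp only [h1, h2, neg_neg]
    · exact Or.inl (hF _ _ X (dist X A) rfl (by rw [hB]) (by rw [hC]))
    · exact Or.inr (hF _ _ X (dist X A) rfl (by rw [hB]) (by rw [hC]))
    · exact Or.inr (hF _ _ X (-dist X A) (by ring) (by rw [hB]; ring) (by rw [hC]; ring))
    · exact Or.inl (hF _ _ X (-dist X A) (by ring) (by rw [hB]; ring) (by rw [hC]; ring))
  refine ⟨G.finite_toSet.subset hsub, ?_⟩
  have hle := (Set.ncard_le_ncard hsub G.finite_toSet).trans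
    ((Set.ncard_coe_finset G).trans_le hG)
  rw [← Int.natCast_floor_eq_floor (dist_nonneg (x := A) (y := B)),
    ← Int.natCast_floor_eq_floor (dist_nonneg (x := A) (y := C))]
  refine (Int.ofNat_le.2 hle).trans_eq ?_
  push_cast
  ring
end

section
/- Let G be a simple graph containing three distinct vertices x₁, x₂, x₃ together with an infinite set Y of vertices such that every y ∈ Y is adjacent in G to each of x₁, x₂, x₃ (i.e. G contains a K(3,ℵ₀)). Then G has no integral realization. -/
/-- An integral realization of a simple graph `G`: an injective map of the
vertices into the Euclidean plane such that no three image points are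
collinear, and two distinct vertices are adjacent iff their images are at
integer distance. -/
def IsIntegralRealization {V : Type*} (G : SimpleGraph V)
    (f : V → EuclideanSpace ℝ (Fin 2)) : Prop :=
  Function.Injective f ∧
  (∀ p q r : EuclideanSpace ℝ (Fin 2), p ∈ Set.range f → q ∈ Set.range f →
      r ∈ Set.range f → p ≠ q → q ≠ r → p ≠ r →
      ¬ Collinear ℝ ({p, q, r} : Set (EuclideanSpace ℝ (Fin 2)))) ∧
  (∀ u v : V, u ≠ v → (G.Adj u v ↔ ∃ n : ℤ, dist (f u) (f v) = (n : ℝ)))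

/-- A vector of the plane orthogonal to two sides of a nondegenerate triangle vanishes. -/
lemma eq_zero_of_inner_eq_zero_of_not_collinear {a b c w : EuclideanSpace ℝ (Fin 2)}
    (h : ¬ Collinear ℝ ({a, b, c} : Set (EuclideanSpace ℝ (Fin 2))))
    (hb : inner ℝ w (b - a) = 0) (hc : inner ℝ w (c - a) = 0) : w = 0 := by
  by_contra hw
  apply h
  have hpos : w 0 ^ 2 + w 1 ^ 2 ≠ 0 := by
    intro h0
    apply hw
    ext i
    fin_cases i
    · simp only [Fin.zero_eta, PiLp.zero_apply]
      nlinarith [sq_nonneg (w 0), sq_nonneg (w 1)]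
    · simp only [Fin.mk_one, PiLp.zero_apply]
      nlinarith [sq_nonneg (w 0), sq_nonneg (w 1)]
  have key : ∀ p : EuclideanSpace ℝ (Fin 2), inner ℝ w (p - a) = 0 →
      ∃ r : ℝ, p = r • !₂[-w 1, w 0] +ᵥ a := by
    intro p hp
    simp only [PiLp.inner_apply, Fin.sum_univ_two, PiLp.sub_apply, RCLike.inner_apply,
      conj_trivial] at hp
    refine ⟨((p 1 - a 1) * w 0 - (p 0 - a 0) * w 1) / (w 0 ^ 2 + w 1 ^ 2), ?_⟩
    ext i
    fin_cases i
    · simp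
      field_simp
      linear_combination w 0 * hp
    · simp
      field_simp
      linear_combination w 1 * hp
  rw [collinear_iff_of_mem (p₀ := a) (by simp)]
  refine ⟨!₂[-w 1, w 0], ?_⟩
  rintro p (rfl | rfl | rfl)
  · exact ⟨0, by simp⟩
  · exact key _ hb
  · exact key _ hc

/-- On a branch of a hyperbola with foci `a` and `b`, the position along the focal axis is an
affine function of the distance to `a`. -/
lemma inner_sub_eq_of_dist_sub_dist_eq {E : Type*} [NormedAddCommGroup E] [InnerProductSpace ℝ E]
    {a b p q : E} (h : dist p b - dist p a = dist q b - dist q a) :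
    inner ℝ (p - q) (b - a) = -(dist p a - dist q a) * (dist p b - dist p a) := by
  have hsq : ∀ x : E, dist x b ^ 2 = dist x a ^ 2 - 2 * inner ℝ (x - a) (b - a) + dist b a ^ 2 := by
    intro x
    rw [dist_eq_norm x b, ← sub_sub_sub_cancel_right x b a, norm_sub_sq_real, dist_eq_norm,
      dist_eq_norm]
  have hp := hsq p
  have hq := hsq q
  have hpq : inner ℝ (p - q) (b - a) = inner ℝ (p - a) (b - a) - inner ℝ (q - a) (b - a) := by
    rw [← inner_sub_left, sub_sub_sub_cancel_right]
  have hqb : dist q b = dist q a + (dist p b - dist p a) := by linarith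
  rw [hqb] at hq
  rw [hpq]
  linear_combination (hp - hq) / 2

/-- Three points of the plane having the same differences of distances to the vertices of a
nondegenerate triangle are collinear. -/
lemma collinear_of_dist_sub_dist_eq {a b c p q r : EuclideanSpace ℝ (Fin 2)}
    (h : ¬ Collinear ℝ ({a, b, c} : Set (EuclideanSpace ℝ (Fin 2))))
    (hpq_b : dist p b - dist p a = dist q b - dist q a)
    (hpq_c : dist p c - dist p a = dist q c - dist q a)
    (hpr_b : dist p b - dist p a = dist r b - dist r a)
    (hpr_c : dist p c - dist p a = dist r c - dist r a) :
    Collinear ℝ ({p, q, r} : Set (EuclideanSpace ℝ (Fin 2))) := by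
  have iqb := inner_sub_eq_of_dist_sub_dist_eq hpq_b
  have iqc := inner_sub_eq_of_dist_sub_dist_eq hpq_c
  have irb := inner_sub_eq_of_dist_sub_dist_eq hpr_b
  have irc := inner_sub_eq_of_dist_sub_dist_eq hpr_c
  by_cases hs : dist p a - dist q a = 0
  · have hpq : p - q = 0 := eq_zero_of_inner_eq_zero_of_not_collinear h
      (by rw [iqb, hs]; ring) (by rw [iqc, hs]; ring)
    rw [sub_eq_zero.mp hpq, Set.insert_eq_of_mem (Set.mem_insert q {r})]
    exact collinear_pair ℝ q r
  · have hw : (dist p a - dist r a) • (p - q) - (dist p a - dist q a) • (p - r) = 0 := by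
      apply eq_zero_of_inner_eq_zero_of_not_collinear h
      · rw [inner_sub_left, real_inner_smul_left, real_inner_smul_left, iqb, irb]; ring
      · rw [inner_sub_left, real_inner_smul_left, real_inner_smul_left, iqc, irc]; ring
    rw [collinear_iff_of_mem (p₀ := p) (by simp)]
    refine ⟨p - q, ?_⟩
    rintro x (rfl | rfl | rfl)
    · exact ⟨0, by simp⟩
    · exact ⟨-1, by simp⟩
    · refine ⟨-((dist p a - dist x a) / (dist p a - dist q a)), ?_⟩
      have hx : p - x = ((dist p a - dist x a) / (dist p a - dist q a)) • (p - q) := by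
        rw [div_eq_inv_mul, mul_smul, sub_eq_zero.mp hw, smul_smul, inv_mul_cancel₀ hs, one_smul]
      rw [neg_smul, ← hx, vadd_eq_add]
      abel

lemma finite_setOf_intCast_abs_le (R : ℝ) : {x : ℝ | |x| ≤ R ∧ ∃ n : ℤ, x = n}.Finite := by
  refine ((Set.finite_Icc (-⌈R⌉) ⌈R⌉).image (fun n : ℤ => (n : ℝ))).subset ?_
  rintro _ ⟨hR, n, rfl⟩
  refine ⟨n, abs_le.mp ?_, rfl⟩
  exact_mod_cast hR.trans (Int.le_ceil R)

theorem no_integral_realization_of_K3_aleph0 {V : Type*} (G : SimpleGraph V)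
    (x₁ x₂ x₃ : V) (hx12 : x₁ ≠ x₂) (hx13 : x₁ ≠ x₃) (hx23 : x₂ ≠ x₃)
    (Y : Set V) (hY : Y.Infinite)
    (hadj : ∀ y ∈ Y, G.Adj x₁ y ∧ G.Adj x₂ y ∧ G.Adj x₃ y) :
    ¬ ∃ f : V → EuclideanSpace ℝ (Fin 2), IsIntegralRealization G f := by
  rintro ⟨f, hinj, hcol, hint⟩
  have hcol' : ∀ u v w : V, u ≠ v → v ≠ w → u ≠ w →
      ¬ Collinear ℝ ({f u, f v, f w} : Set (EuclideanSpace ℝ (Fin 2))) := fun u v w huv hvw huw =>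
    hcol _ _ _ ⟨u, rfl⟩ ⟨v, rfl⟩ ⟨w, rfl⟩ (hinj.ne huv) (hinj.ne hvw) (hinj.ne huw)
  have hdist : ∀ u v : V, G.Adj u v → ∃ n : ℤ, dist (f v) (f u) = n := fun u v huv =>
    (hint v u huv.ne').mp huv.symm
  have hdiff : ∀ x y : V, G.Adj x₁ y → G.Adj x y →
      dist (f y) (f x) - dist (f y) (f x₁) ∈
        {t : ℝ | |t| ≤ dist (f x) (f x₁) ∧ ∃ n : ℤ, t = n} := by
    intro x y h₁ h
    obtain ⟨m, hm⟩ := hdist x₁ y h₁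
    obtain ⟨n, hn⟩ := hdist x y h
    refine ⟨?_, n - m, by rw [hm, hn]; push_cast; rfl⟩
    rw [dist_comm (f y), dist_comm (f y)]
    exact abs_dist_sub_le _ _ _
  let g : V → ℝ × ℝ := fun y =>
    (dist (f y) (f x₂) - dist (f y) (f x₁), dist (f y) (f x₃) - dist (f y) (f x₁))
  apply hY
  refine Set.Finite.of_finite_fibers g ?_ ?_
  · refine ((finite_setOf_intCast_abs_le (dist (f x₂) (f x₁))).prod
      (finite_setOf_intCast_abs_le (dist (f x₃) (f x₁)))).subset ?_
    rintro _ ⟨y, hy, rfl⟩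
    obtain ⟨h₁, h₂, h₃⟩ := hadj y hy
    exact ⟨hdiff x₂ y h₁ h₂, hdiff x₃ y h₁ h₃⟩
  · intro z _
    classical
    by_contra hinf
    obtain ⟨t, ht, hcard⟩ := Set.Infinite.exists_subset_card_eq hinf 3
    obtain ⟨u, v, w, huv, huw, hvw, rfl⟩ := Finset.card_eq_three.mp hcard
    have hu : g u = z := (ht (by simp : u ∈ _)).2
    have hv : g v = z := (ht (by simp : v ∈ _)).2
    have hw : g w = z := (ht (by simp : w ∈ _)).2
    have guv := Prod.ext_iff.mp (hu.trans hv.symm)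
    have guw := Prod.ext_iff.mp (hu.trans hw.symm)
    exact hcol' u v w huv hvw huw (collinear_of_dist_sub_dist_eq
      (hcol' x₁ x₂ x₃ hx12 hx23 hx13) guv.1 guv.2 guw.1 guw.2)
end

section
/- Let P, Q, R be three noncollinear points in the Euclidean plane ℝ² whose pairwise distances are all integers, and let a = min{dist(P,Q), dist(Q,R), dist(P,R)}. Then the distance from each of the three points to the affine line through the other two is at least √(a − 1/4). -/
/-- For a triangle with base `x` and sides `z` and `z + d`, the quantity
`(s² - x²)(x² - d²)` with `s = 2z + d` is `4x²` times the square of the height over the base. -/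
theorem heron_ge_of_gap {x z d : ℝ} (hz : 1 ≤ z) (hd : 0 ≤ d) (h₁ : d + 1 ≤ x)
    (h₂ : x ≤ 2 * z + d - 1) :
    (4 * z - 1) * x ^ 2 ≤ ((2 * z + d) ^ 2 - x ^ 2) * (x ^ 2 - d ^ 2) := by
  have hA : (d + 1) ^ 2 ≤ x ^ 2 := by gcongr
  have hB : x ^ 2 ≤ (2 * z + d - 1) ^ 2 := by
    have : 0 ≤ x := by linarith
    gcongr
  have fA : 0 ≤ ((2 * z + d) ^ 2 - (d + 1) ^ 2) * ((d + 1) ^ 2 - d ^ 2)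
      - (4 * z - 1) * (d + 1) ^ 2 := by
    obtain ⟨w, rfl⟩ : ∃ w, z = w + 1 := ⟨z - 1, by ring⟩
    have hw : 0 ≤ w := by linarith
    ring_nf
    positivity
  have fB : 0 ≤ ((2 * z + d) ^ 2 - (2 * z + d - 1) ^ 2) * ((2 * z + d - 1) ^ 2 - d ^ 2)
      - (4 * z - 1) * (2 * z + d - 1) ^ 2 := by
    obtain ⟨w, rfl⟩ : ∃ w, z = w + 1 := ⟨z - 1, by ring⟩
    have hw : 0 ≤ w := by linarith
    ring_nf
    positivity
  generalize x ^ 2 = X at *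
  generalize hAe : (d + 1) ^ 2 = A at *
  generalize hBe : (2 * z + d - 1) ^ 2 = B at *
  rcases (hA.trans hB).eq_or_lt with h | h
  · obtain rfl : X = A := le_antisymm (hB.trans h.ge) hA
    linarith
  · have key := add_nonneg (add_nonneg (mul_nonneg (sub_nonneg.2 hB) fA)
      (mul_nonneg (sub_nonneg.2 hA) fB))
      (mul_nonneg (mul_nonneg (sub_nonneg.2 h.le) (sub_nonneg.2 hA)) (sub_nonneg.2 hB))
    refine sub_nonneg.1 (nonneg_of_mul_nonneg_right (a := B - A) ?_ (sub_pos.2 h))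
    convert key using 1
    ring

theorem heron_ge_of_integer_sides {x y z : ℤ} (hx : x < y + z) (hy : y < x + z) (hz : z < x + y) :
    (4 * min (y : ℝ) z - 1) * (x : ℝ) ^ 2 ≤
      4 * (x : ℝ) ^ 2 * (y : ℝ) ^ 2 - ((x : ℝ) ^ 2 + (y : ℝ) ^ 2 - (z : ℝ) ^ 2) ^ 2 := by
  rcases le_total y z with h | h
  · rw [min_eq_left (by exact_mod_cast h)]
    have := heron_ge_of_gap (x := x) (z := y) (d := z - y)
      (by exact_mod_cast (by omega : 1 ≤ y)) (by exact_mod_cast (by omega : 0 ≤ z - y))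
      (by exact_mod_cast (by omega : z - y + 1 ≤ x))
      (by exact_mod_cast (by omega : x ≤ 2 * y + (z - y) - 1))
    linarith
  · rw [min_eq_right (by exact_mod_cast h)]
    have := heron_ge_of_gap (x := x) (z := z) (d := y - z)
      (by exact_mod_cast (by omega : 1 ≤ z)) (by exact_mod_cast (by omega : 0 ≤ y - z))
      (by exact_mod_cast (by omega : y - z + 1 ≤ x))
      (by exact_mod_cast (by omega : x ≤ 2 * z + (y - z) - 1))
    linarith

theorem dist_lt_dist_add_dist_of_not_collinear {V : Type*} [NormedAddCommGroup V]
    [InnerProductSpace ℝ V] {A B C : V} (h : ¬ Collinear ℝ ({A, B, C} : Set V)) :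
    dist A C < dist A B + dist B C :=
  lt_of_le_of_ne (dist_triangle A B C) fun he => h (dist_add_dist_eq_iff.1 he.symm).collinear

theorem heron_le_sq_dist_lineMap {V : Type*} [NormedAddCommGroup V]
    [InnerProductSpace ℝ V] (P Q R : V) (t : ℝ) :
    4 * dist Q R ^ 2 * dist P Q ^ 2 - (dist Q R ^ 2 + dist P Q ^ 2 - dist P R ^ 2) ^ 2 ≤
      4 * dist Q R ^ 2 * dist P (AffineMap.lineMap Q R t) ^ 2 := by
  have h₁ : dist P R ^ 2 = dist P Q ^ 2 - 2 * inner ℝ (P - Q) (R - Q) + dist Q R ^ 2 := by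
    rw [dist_comm Q R, dist_eq_norm, dist_eq_norm, dist_eq_norm, ← norm_sub_sq_real]
    congr 2
    abel
  have h₂ : dist P (AffineMap.lineMap Q R t) ^ 2 =
      dist P Q ^ 2 - 2 * (t * inner ℝ (P - Q) (R - Q)) + t ^ 2 * dist Q R ^ 2 := by
    have : P - AffineMap.lineMap Q R t = (P - Q) - t • (R - Q) := by
      rw [AffineMap.lineMap_apply, vsub_eq_sub, vadd_eq_add]
      abel
    rw [dist_comm Q R, dist_eq_norm, dist_eq_norm, dist_eq_norm, this, norm_sub_sq_real,
      inner_smul_right, norm_smul, mul_pow, Real.norm_eq_abs, sq_abs]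
  rw [h₁, h₂]
  nlinarith [sq_nonneg (2 * t * dist Q R ^ 2 - 2 * inner ℝ (P - Q) (R - Q))]

theorem sqrt_min_le_infDist_of_integer_sides {V : Type*} [NormedAddCommGroup V]
    [InnerProductSpace ℝ V] {P Q R : V} (h : ¬ Collinear ℝ ({P, Q, R} : Set V))
    (hPQ : ∃ n : ℤ, dist P Q = (n : ℝ)) (hQR : ∃ n : ℤ, dist Q R = (n : ℝ))
    (hPR : ∃ n : ℤ, dist P R = (n : ℝ)) :
    √(min (dist P Q) (dist P R) - 1 / 4) ≤
      Metric.infDist P (affineSpan ℝ ({Q, R} : Set V) : Set V) := by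
  have tR := dist_lt_dist_add_dist_of_not_collinear h
  have tQ := dist_lt_dist_add_dist_of_not_collinear (A := P) (B := R) (C := Q)
    (by rwa [Set.pair_comm])
  have tP := dist_lt_dist_add_dist_of_not_collinear (A := Q) (B := P) (C := R)
    (by rwa [Set.insert_comm])
  rw [dist_comm R Q] at tQ
  rw [dist_comm Q P] at tP
  have hpos : 0 < dist Q R := by linarith
  refine (Metric.le_infDist ⟨Q, left_mem_affineSpan_pair ℝ Q R⟩).2 fun Y hY => ?_
  obtain ⟨t, rfl⟩ : ∃ t : ℝ, AffineMap.lineMap Q R t = Y := by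
    obtain ⟨t, ht⟩ := vadd_left_mem_affineSpan_pair.1
      ((vsub_vadd Y Q).symm ▸ hY : (Y -ᵥ Q) +ᵥ Q ∈ affineSpan ℝ {Q, R})
    exact ⟨t, by rw [AffineMap.lineMap_apply, ht, vsub_vadd]⟩
  refine Real.sqrt_le_iff.2 ⟨dist_nonneg, ?_⟩
  have key := heron_le_sq_dist_lineMap P Q R t
  obtain ⟨y, hy⟩ := hPQ
  obtain ⟨x, hx⟩ := hQR
  obtain ⟨z, hz⟩ := hPR
  rw [hx, hy, hz] at key tP tQ tR
  rw [hx] at hpos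
  rw [hy, hz]
  have hh := (heron_ge_of_integer_sides (x := x) (y := y) (z := z) (by exact_mod_cast tP)
    (by rw [add_comm]; exact_mod_cast tQ) (by rw [add_comm]; exact_mod_cast tR)).trans key
  have := le_of_mul_le_mul_right (a := (x : ℝ) ^ 2) (b := 4 * min (y : ℝ) z - 1)
    (c := 4 * dist P (AffineMap.lineMap Q R t) ^ 2) (by linarith) (by positivity)
  linarith

theorem integral_triangle_height (P Q R : EuclideanSpace ℝ (Fin 2))
    (hPQR : ¬ Collinear ℝ ({P, Q, R} : Set (EuclideanSpace ℝ (Fin 2))))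
    (hPQ : ∃ n : ℤ, dist P Q = (n : ℝ))
    (hQR : ∃ n : ℤ, dist Q R = (n : ℝ))
    (hPR : ∃ n : ℤ, dist P R = (n : ℝ)) :
    Real.sqrt (min (dist P Q) (min (dist Q R) (dist P R)) - 1/4) ≤
        Metric.infDist P (affineSpan ℝ ({Q, R} : Set (EuclideanSpace ℝ (Fin 2))) : Set (EuclideanSpace ℝ (Fin 2))) ∧
    Real.sqrt (min (dist P Q) (min (dist Q R) (dist P R)) - 1/4) ≤
        Metric.infDist Q (affineSpan ℝ ({P, R} : Set (EuclideanSpace ℝ (Fin 2))) : Set (EuclideanSpace ℝ (Fin 2))) ∧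
    Real.sqrt (min (dist P Q) (min (dist Q R) (dist P R)) - 1/4) ≤
        Metric.infDist R (affineSpan ℝ ({P, Q} : Set (EuclideanSpace ℝ (Fin 2))) : Set (EuclideanSpace ℝ (Fin 2))) := by
  refine ⟨(Real.sqrt_le_sqrt ?_).trans (sqrt_min_le_infDist_of_integer_sides hPQR hPQ hQR hPR),
    (Real.sqrt_le_sqrt ?_).trans (sqrt_min_le_infDist_of_integer_sides
      (by rwa [Set.insert_comm]) (by rwa [dist_comm]) hPR hQR),
    (Real.sqrt_le_sqrt ?_).trans (sqrt_min_le_infDist_of_integer_sides (P := R) (Q := P) (R := Q)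
      (by rwa [Set.insert_comm, Set.pair_comm R Q]) (by rwa [dist_comm]) hPQ (by rwa [dist_comm]))⟩
  · gcongr
    exact min_le_right _ _
  · rw [dist_comm Q P]
    gcongr
    exact min_le_left (dist Q R) _
  · rw [dist_comm R P, dist_comm R Q, min_comm (dist P R) (dist Q R)]
    exact sub_le_sub_right (min_le_right _ _) _
end

section
/- Let A, B > 0 and consider the hyperbola H = {(x,y) ∈ ℝ² : x²/A² − y²/B² = 1}. Let P = (x₁,y₁) and Q = (x₂,y₂) be two distinct points of H lying on the same arc, i.e. x₁x₂ > 0 and y₁y₂ ≥ 0. Then the line through P and Q intersects the segment [−A, A] × {0} of the x-axis: there exists a point (t, 0) on the line through P and Q with −A ≤ t ≤ A. -/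
/-- For points `(a, b)`, `(c, d)` on the same branch of the unit hyperbola, the Lorentzian product
`a * c - b * d` is at least `1`. -/
lemma one_add_mul_le_mul_of_unit_hyperbola {a b c d : ℝ} (h₁ : a ^ 2 - b ^ 2 = 1)
    (h₂ : c ^ 2 - d ^ 2 = 1) (hac : 0 < a * c) : 1 + b * d ≤ a * c := by
  refine le_of_sq_le_sq ?_ hac.le
  have : (a * c) ^ 2 = (1 + b ^ 2) * (1 + d ^ 2) := by
    linear_combination a ^ 2 * h₂ + (1 + d ^ 2) * h₁
  nlinarith [sq_nonneg (b - d)]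

/-- Two points on the same branch of the unit hyperbola at the same height coincide. -/
lemma eq_of_unit_hyperbola_of_snd_eq {a b c : ℝ} (h₁ : a ^ 2 - b ^ 2 = 1)
    (h₂ : c ^ 2 - b ^ 2 = 1) (hac : 0 < a * c) : a = c := by
  rcases sq_eq_sq_iff_eq_or_eq_neg.mp (show a ^ 2 = c ^ 2 by linarith) with h | h
  · exact h
  · nlinarith [sq_nonneg c]

/-- The chord through two points on the same arc of the unit hyperbola meets the axis in
`[-1, 1]`. -/
lemma abs_chord_intercept_le_one {a b c d : ℝ} (h₁ : a ^ 2 - b ^ 2 = 1)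
    (h₂ : c ^ 2 - d ^ 2 = 1) (hac : 0 < a * c) (hbd : 0 ≤ b * d) :
    |(a * d - c * b) / (d - b)| ≤ 1 := by
  rw [abs_div]
  refine div_le_one_of_le₀ (sq_le_sq.mp ?_) (abs_nonneg _)
  have key := mul_nonneg hbd
    (sub_nonneg.mpr (one_add_mul_le_mul_of_unit_hyperbola h₁ h₂ hac))
  have : (a * d - c * b) ^ 2 = (1 + b ^ 2) * d ^ 2 + (1 + d ^ 2) * b ^ 2
      - 2 * (a * c) * (b * d) := by
    linear_combination d ^ 2 * h₁ + b ^ 2 * h₂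
  nlinarith

theorem line_through_same_arc_points_crosses_segment (A B : ℝ) (hA : 0 < A) (hB : 0 < B)
    (P Q : ℝ × ℝ) (hPQ : P ≠ Q)
    (hP : P.1 ^ 2 / A ^ 2 - P.2 ^ 2 / B ^ 2 = 1)
    (hQ : Q.1 ^ 2 / A ^ 2 - Q.2 ^ 2 / B ^ 2 = 1)
    (hx : P.1 * Q.1 > 0) (hy : P.2 * Q.2 ≥ 0) :
    ∃ t : ℝ, -A ≤ t ∧ t ≤ A ∧ ((t, (0 : ℝ)) : ℝ × ℝ) ∈ affineSpan ℝ ({P, Q} : Set (ℝ × ℝ)) := by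
  obtain ⟨x₁, y₁⟩ := P
  obtain ⟨x₂, y₂⟩ := Q
  simp only [← div_pow] at hP hQ hx hy
  have hac : 0 < x₁ / A * (x₂ / A) := by rw [div_mul_div_comm]; positivity
  have hbd : 0 ≤ y₁ / B * (y₂ / B) := by rw [div_mul_div_comm]; positivity
  have hne : y₂ - y₁ ≠ 0 := by
    intro h
    obtain rfl : y₂ = y₁ := sub_eq_zero.mp h
    have hx_eq := eq_of_unit_hyperbola_of_snd_eq hP hQ hac
    exact hPQ (by rw [(div_left_inj' hA.ne').mp hx_eq])
  have hscale : (x₁ / A * (y₂ / B) - x₂ / A * (y₁ / B)) / (y₂ / B - y₁ / B)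
      = (x₁ * y₂ - x₂ * y₁) / (y₂ - y₁) / A := by
    rw [← sub_div]
    field_simp
  have hle := abs_chord_intercept_le_one hP hQ hac hbd
  rw [hscale, abs_div, abs_of_pos hA, div_le_one hA, abs_le] at hle
  refine ⟨_, hle.1, hle.2, ?_⟩
  convert AffineMap.lineMap_mem_affineSpan_pair (-y₁ / (y₂ - y₁)) (x₁, y₁) (x₂, y₂) using 1
  ext <;> simp [AffineMap.lineMap_apply] <;> field_simp <;> ring
end

section
/- Let A, B > 0, let c = √(A² + B²), and let F₁ = (−c, 0), F₂ = (c, 0) be the foci of the hyperbola H = {(x,y) ∈ ℝ² : x²/A² − y²/B² = 1}. Let P = (x₁,y₁) and Q = (x₂,y₂) be two distinct points of H lying on the same arc, i.e. x₁x₂ > 0 and y₁y₂ ≥ 0. Then the distance from F₁ to the affine line through P and Q is at most dist(F₁, F₂). -/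
/-- A chord joining two points `(x₁, y₁)`, `(x₂, y₂)` of the same arc of the hyperbola with
semi-axes `A` and `B` meets the `x`-axis between the two vertices. -/
theorem sq_det_le_of_same_arc {A B x₁ y₁ x₂ y₂ : ℝ} (hA : 0 < A) (hB : 0 < B)
    (h₁ : x₁ ^ 2 / A ^ 2 - y₁ ^ 2 / B ^ 2 = 1) (h₂ : x₂ ^ 2 / A ^ 2 - y₂ ^ 2 / B ^ 2 = 1)
    (hx : 0 < x₁ * x₂) (hy : 0 ≤ y₁ * y₂) :
    (x₁ * y₂ - x₂ * y₁) ^ 2 ≤ (A * (y₂ - y₁)) ^ 2 := by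
  have e₁ : x₁ ^ 2 = A ^ 2 * (1 + (y₁ / B) ^ 2) := by
    field_simp at h₁ ⊢
    linarith
  have e₂ : x₂ ^ 2 = A ^ 2 * (1 + (y₂ / B) ^ 2) := by
    field_simp at h₂ ⊢
    linarith
  have key : A ^ 2 * (1 + y₁ / B * (y₂ / B)) ≤ x₁ * x₂ := by
    refine le_of_sq_le_sq ?_ hx.le
    rw [mul_pow x₁, e₁, e₂]
    nlinarith [mul_nonneg (sq_nonneg (A ^ 2)) (sq_nonneg (y₁ / B - y₂ / B))]
  have expand : (A * (y₂ - y₁)) ^ 2 - (x₁ * y₂ - x₂ * y₁) ^ 2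
      = 2 * ((y₁ * y₂) * (x₁ * x₂ - A ^ 2 * (1 + y₁ / B * (y₂ / B)))) := by
    have : (x₁ * y₂ - x₂ * y₁) ^ 2
        = x₁ ^ 2 * y₂ ^ 2 + x₂ ^ 2 * y₁ ^ 2 - 2 * (x₁ * x₂ * (y₁ * y₂)) := by ring
    rw [this, e₁, e₂]
    ring
  linarith [mul_nonneg hy (sub_nonneg.2 key)]

/-- Two points of the same arc of a hyperbola with the same ordinate have the same abscissa. -/
theorem abscissa_eq_of_same_arc {A B x₁ x₂ y : ℝ} (hA : 0 < A)
    (h₁ : x₁ ^ 2 / A ^ 2 - y ^ 2 / B ^ 2 = 1) (h₂ : x₂ ^ 2 / A ^ 2 - y ^ 2 / B ^ 2 = 1)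
    (hx : 0 < x₁ * x₂) : x₁ = x₂ := by
  have h : x₁ ^ 2 / A ^ 2 = x₂ ^ 2 / A ^ 2 := by linarith
  rw [div_left_inj' (by positivity)] at h
  rcases sq_eq_sq_iff_eq_or_eq_neg.1 h with h | h
  · exact h
  · subst h
    nlinarith [sq_nonneg x₂]

theorem focus_close_to_chord_of_same_arc (A B : ℝ) (hA : 0 < A) (hB : 0 < B)
    (F₁ F₂ P Q : EuclideanSpace ℝ (Fin 2))
    (hF₁ : F₁ = ![-Real.sqrt (A ^ 2 + B ^ 2), 0])
    (hF₂ : F₂ = ![Real.sqrt (A ^ 2 + B ^ 2), 0])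
    (hPQ : P ≠ Q)
    (hP : (P 0) ^ 2 / A ^ 2 - (P 1) ^ 2 / B ^ 2 = 1)
    (hQ : (Q 0) ^ 2 / A ^ 2 - (Q 1) ^ 2 / B ^ 2 = 1)
    (hx : P 0 * Q 0 > 0) (hy : P 1 * Q 1 ≥ 0) :
    Metric.infDist F₁
        (affineSpan ℝ ({P, Q} : Set (EuclideanSpace ℝ (Fin 2))) : Set (EuclideanSpace ℝ (Fin 2)))
      ≤ dist F₁ F₂ := by
  set c := Real.sqrt (A ^ 2 + B ^ 2) with hc
  have hAc : A ≤ c := Real.le_sqrt_of_sq_le (by nlinarith [sq_nonneg B])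
  have hne : Q 1 - P 1 ≠ 0 := by
    intro h
    have h1 : Q 1 = P 1 := by linarith
    rw [h1] at hQ
    apply hPQ
    ext i
    fin_cases i
    · exact abscissa_eq_of_same_arc hA hP hQ hx
    · exact h1.symm
  have hdet := sq_le_sq.1 (sq_det_le_of_same_arc hA hB hP hQ hx hy)
  set t := (P 0 * Q 1 - Q 0 * P 1) / (Q 1 - P 1) with ht
  have htA : |t| ≤ A := by
    rw [ht, abs_div, div_le_iff₀ (abs_pos.2 hne)]
    rwa [abs_mul, abs_of_pos hA] at hdet
  set R := AffineMap.lineMap P Q (-P 1 / (Q 1 - P 1)) with hR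
  have hR0 : R 0 = t := by
    simp only [hR, ht, AffineMap.lineMap_apply, vsub_eq_sub, vadd_eq_add, PiLp.add_apply,
      PiLp.smul_apply, PiLp.sub_apply, smul_eq_mul]
    field_simp
    ring
  have hR1 : R 1 = 0 := by
    simp only [hR, AffineMap.lineMap_apply, vsub_eq_sub, vadd_eq_add, PiLp.add_apply,
      PiLp.smul_apply, PiLp.sub_apply, smul_eq_mul]
    field_simp
    ring
  have hF10 : F₁ 0 = -c := by rw [hF₁]; rfl
  have hF11 : F₁ 1 = 0 := by rw [hF₁]; rfl
  have hF20 : F₂ 0 = c := by rw [hF₂]; rfl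
  have hF21 : F₂ 1 = 0 := by rw [hF₂]; rfl
  refine (Metric.infDist_le_dist_of_mem
    (AffineMap.lineMap_mem_affineSpan_pair (-P 1 / (Q 1 - P 1)) P Q)).trans ?_
  rw [← hR, EuclideanSpace.dist_eq, EuclideanSpace.dist_eq]
  apply Real.sqrt_le_sqrt
  simp only [Fin.sum_univ_two, hF10, hF11, hF20, hF21, hR0, hR1, Real.dist_eq, sq_abs]
  obtain ⟨h1, h2⟩ := abs_le.1 htA
  nlinarith
end

section
/- Let A, B > 0, let c = √(A² + B²), and let F₁ = (−c, 0), F₂ = (c, 0) be the foci of the hyperbola H = {(x,y) ∈ ℝ² : x²/A² − y²/B² = 1}. Let P = (x₁,y₁) and Q = (x₂,y₂) be two distinct points of H with x₁x₂ > 0 and y₁y₂ > 0 (same open quadrant). Let a ≥ 1 be a real number such that dist(F₁,F₂) ≤ √(a − 1/4) and such that dist(P,Q) ≥ a, dist(F₁,P) ≥ a and dist(F₁,Q) ≥ a. Then the three distances dist(P,Q), dist(F₁,P), dist(F₁,Q) are not all integers (P, Q, F₁ is not an integral triangle). -/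
/-- Core inequality: in normalised coordinates `x = |X| / A`, `y = |Y| / B` on the hyperbola, with
focal distances `c * x + s`, the three side lengths cannot all be integers. -/
theorem not_integral_of_normalised {A B c x₁ y₁ x₂ y₂ s a : ℝ} (hB : 0 < B) (hc : 0 < c)
    (hABc : A ^ 2 + B ^ 2 = c ^ 2) (hsc : s ≤ c) (ha : 1 ≤ a) (hca : 4 * c ^ 2 ≤ a - 1 / 4)
    (hx₁ : 0 < x₁) (hy₁ : 0 < y₁) (hy₂ : 0 < y₂)
    (h₁ : x₁ ^ 2 - y₁ ^ 2 = 1) (h₂ : x₂ ^ 2 - y₂ ^ 2 = 1) (hlt : x₁ < x₂)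
    (hpa : a ≤ c * x₁ + s) {d p q : ℤ} (hda : a ≤ d)
    (hd : (d : ℝ) ^ 2 = A ^ 2 * (x₁ - x₂) ^ 2 + B ^ 2 * (y₁ - y₂) ^ 2)
    (hp : (p : ℝ) = c * x₁ + s) (hq : (q : ℝ) = c * x₂ + s) : False := by
  have hy : y₁ < y₂ := by
    have := pow_lt_pow_left₀ hlt hx₁.le two_ne_zero
    exact lt_of_pow_lt_pow_left₀ 2 hy₂.le (by linarith)
  have hB_le : B ≤ c := (sq_le_sq₀ hB.le hc.le).1 (by linarith [sq_nonneg A])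
  have hx₁c : 2 * c ≤ x₁ := by
    have : c * (2 * c) ≤ c * x₁ := by nlinarith [sq_nonneg (c - 1 / 4)]
    exact le_of_mul_le_mul_left this hc
  have hu₁ : 0 < x₁ - y₁ :=
    sub_pos.2 (lt_of_pow_lt_pow_left₀ 2 hx₁.le (by linarith))
  have hu₂ : 0 < x₂ - y₂ :=
    sub_pos.2 (lt_of_pow_lt_pow_left₀ 2 (hx₁.trans hlt).le (by linarith))
  have hBu : 2 * B * (x₁ - y₁) ≤ 1 := by
    have : 2 * B * (x₁ - y₁) ≤ (x₁ + y₁) * (x₁ - y₁) :=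
      mul_le_mul_of_nonneg_right (by linarith) hu₁.le
    linarith
  have hu : 0 < (x₁ - y₁) - (x₂ - y₂) := by
    have e : (x₁ - y₁) * (x₁ + y₁) = (x₂ - y₂) * (x₂ + y₂) := by linarith
    have : (x₂ - y₂) * (x₁ + y₁) < (x₁ - y₁) * (x₁ + y₁) := by
      rw [e]
      exact mul_lt_mul_of_pos_left (by linarith) hu₂
    have := lt_of_mul_lt_mul_right this (by linarith)
    linarith
  have hd0 : (0 : ℝ) < d := by linarith
  have hBd : B * (y₂ - y₁) ≤ d := by
    refine (sq_le_sq₀ (mul_pos hB (sub_pos.2 hy)).le hd0.le).1 ?_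
    linarith [mul_nonneg (sq_nonneg A) (sq_nonneg (x₁ - x₂))]
  have hkey : (d : ℝ) ^ 2 - (q - p) ^ 2
      = (B * ((x₂ + y₂) - (x₁ + y₁))) * (B * ((x₁ - y₁) - (x₂ - y₂))) := by
    rw [hd, hp, hq]
    linear_combination (x₁ - x₂) ^ 2 * hABc
  have hv_pos : 0 < B * ((x₂ + y₂) - (x₁ + y₁)) := mul_pos hB (by linarith)
  have hu_pos : 0 < B * ((x₁ - y₁) - (x₂ - y₂)) := mul_pos hB hu
  have hu_lt : B * ((x₁ - y₁) - (x₂ - y₂)) < 1 / 2 := by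
    linarith [mul_pos hB hu₂]
  have hv_lt : B * ((x₂ + y₂) - (x₁ + y₁)) < 2 * d := by linarith
  have hpos : (0 : ℝ) < (d : ℝ) ^ 2 - (q - p) ^ 2 := hkey ▸ mul_pos hv_pos hu_pos
  have hlt_d : (d : ℝ) ^ 2 - (q - p) ^ 2 < d := by
    rw [hkey]
    linarith [mul_lt_mul_of_pos_left hu_lt hv_pos]
  have hqp : (0 : ℝ) < q - p := by
    rw [hp, hq]
    linarith [mul_lt_mul_of_pos_left hlt hc]
  have hqpd : (q : ℝ) - p < d := lt_of_pow_lt_pow_left₀ 2 hd0.le (by linarith)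
  have hint : (q : ℝ) - p + 1 ≤ d := by
    have : q - p < d := by exact_mod_cast hqpd
    have : q - p + 1 ≤ d := this
    exact_mod_cast this
  have hsq : ((q : ℝ) - p) ^ 2 ≤ (d - 1) ^ 2 :=
    pow_le_pow_left₀ hqp.le (by linarith) 2
  linarith

/-- Distance from a point of the hyperbola to the left focus, in terms of `|X| / A`. -/
theorem dist_left_focus_eq {A B c X Y r : ℝ} (hA : 0 < A) (hB : 0 < B) (hc : 0 < c)
    (hABc : A ^ 2 + B ^ 2 = c ^ 2) (h : X ^ 2 / A ^ 2 - Y ^ 2 / B ^ 2 = 1)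
    (hr : 0 ≤ r) (hrsq : r ^ 2 = (-c - X) ^ 2 + (0 - Y) ^ 2) :
    (0 < X → r = c * (|X| / A) + A) ∧ (X < 0 → r = c * (|X| / A) + -A) := by
  have hsq : r ^ 2 = (c * (X / A) + A) ^ 2 := by
    have hY : Y ^ 2 = B ^ 2 * ((X / A) ^ 2 - 1) := by
      field_simp at h ⊢
      linarith
    have hX : A * (X / A) = X := by field_simp
    rw [hrsq, sub_eq_add_neg 0 Y, zero_add, neg_sq, hY]
    generalize X / A = x at *
    subst hX
    linear_combination (x ^ 2 - 1) * hABc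
  have habs : r = |c * (X / A) + A| := by
    rw [← abs_of_nonneg hr]
    exact (sq_eq_sq_iff_abs_eq_abs _ _).1 hsq
  refine ⟨fun hX => ?_, fun hX => ?_⟩
  · rw [habs, abs_of_pos hX, abs_of_pos (by positivity)]
  · have hAX : 1 ≤ -(X / A) := by
      have h1 : (X / A) ^ 2 = 1 + Y ^ 2 / B ^ 2 := by rw [div_pow]; linarith
      have h2 : 0 ≤ Y ^ 2 / B ^ 2 := by positivity
      have h3 : X / A < 0 := div_neg_of_neg_of_pos hX hA
      nlinarith
    have hAc : A ≤ c := by nlinarith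
    rw [habs, abs_of_neg hX, abs_of_nonpos (by nlinarith)]
    ring


theorem not_integral_triangle_on_hyperbola (A B : ℝ) (hA : 0 < A) (hB : 0 < B)
    (F₁ F₂ P Q : EuclideanSpace ℝ (Fin 2))
    (hF₁ : F₁ = ![-Real.sqrt (A ^ 2 + B ^ 2), 0])
    (hF₂ : F₂ = ![Real.sqrt (A ^ 2 + B ^ 2), 0])
    (hPQ : P ≠ Q)
    (hP : (P 0) ^ 2 / A ^ 2 - (P 1) ^ 2 / B ^ 2 = 1)
    (hQ : (Q 0) ^ 2 / A ^ 2 - (Q 1) ^ 2 / B ^ 2 = 1)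
    (hx : P 0 * Q 0 > 0) (hy : P 1 * Q 1 > 0)
    (a : ℝ) (ha : 1 ≤ a)
    (hfoci : dist F₁ F₂ ≤ Real.sqrt (a - 1/4))
    (hdPQ : dist P Q ≥ a) (hdF₁P : dist F₁ P ≥ a) (hdF₁Q : dist F₁ Q ≥ a) :
    ¬ ((∃ n : ℤ, dist P Q = (n : ℝ)) ∧ (∃ n : ℤ, dist F₁ P = (n : ℝ)) ∧
        (∃ n : ℤ, dist F₁ Q = (n : ℝ))) := by
  rintro ⟨⟨d, hd⟩, ⟨p, hp⟩, ⟨q, hq⟩⟩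
  obtain ⟨c, hcdef⟩ : ∃ c, c = Real.sqrt (A ^ 2 + B ^ 2) := ⟨_, rfl⟩
  rw [← hcdef] at hF₁ hF₂
  have hc : 0 < c := hcdef ▸ Real.sqrt_pos.2 (by positivity)
  have hABc : A ^ 2 + B ^ 2 = c ^ 2 := by rw [hcdef, Real.sq_sqrt (by positivity)]
  have dist_sq (U V : EuclideanSpace ℝ (Fin 2)) :
      dist U V ^ 2 = (U 0 - V 0) ^ 2 + (U 1 - V 1) ^ 2 := by
    rw [EuclideanSpace.dist_eq, Real.sq_sqrt (by positivity)]
    simp [Fin.sum_univ_two, Real.dist_eq]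
  have hF₁0 : F₁ 0 = -c := by simp [hF₁]
  have hF₁1 : F₁ 1 = 0 := by simp [hF₁]
  have hF₂0 : F₂ 0 = c := by simp [hF₂]
  have hF₂1 : F₂ 1 = 0 := by simp [hF₂]
  have hca : 4 * c ^ 2 ≤ a - 1 / 4 := by
    have h1 := pow_le_pow_left₀ dist_nonneg hfoci 2
    rw [dist_sq, Real.sq_sqrt (by linarith), hF₁0, hF₁1, hF₂0, hF₂1] at h1
    linarith
  have hAc : A ≤ c := by nlinarith
  have hP0 : P 0 ≠ 0 := left_ne_zero_of_mul hx.ne'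
  have hQ0 : Q 0 ≠ 0 := right_ne_zero_of_mul hx.ne'
  have hP1 : P 1 ≠ 0 := left_ne_zero_of_mul hy.ne'
  have hQ1 : Q 1 ≠ 0 := right_ne_zero_of_mul hy.ne'
  have hPf := dist_left_focus_eq hA hB hc hABc hP dist_nonneg
    (by rw [dist_sq F₁ P, hF₁0, hF₁1])
  have hQf := dist_left_focus_eq hA hB hc hABc hQ dist_nonneg
    (by rw [dist_sq F₁ Q, hF₁0, hF₁1])
  obtain ⟨s, hsc, hps, hqs⟩ : ∃ s, s ≤ c ∧ dist F₁ P = c * (|P 0| / A) + s ∧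
      dist F₁ Q = c * (|Q 0| / A) + s := by
    rcases lt_or_gt_of_ne hP0 with h | h
    · exact ⟨-A, by linarith, hPf.2 h, hQf.2 (by nlinarith)⟩
    · exact ⟨A, hAc, hPf.1 h, hQf.1 (by nlinarith)⟩
  have normalise {X Y : ℝ} (h : X ^ 2 / A ^ 2 - Y ^ 2 / B ^ 2 = 1) :
      (|X| / A) ^ 2 - (|Y| / B) ^ 2 = 1 := by
    rwa [div_pow, div_pow, sq_abs, sq_abs]
  have abs_sub_sq {u v : ℝ} (h : u * v > 0) : (|u| - |v|) ^ 2 = (u - v) ^ 2 := by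
    have huv : |u| * |v| = u * v := by rw [← abs_mul, abs_of_pos h]
    linear_combination sq_abs u + sq_abs v - 2 * huv
  have hdd : (d : ℝ) ^ 2 = A ^ 2 * (|P 0| / A - |Q 0| / A) ^ 2
      + B ^ 2 * (|P 1| / B - |Q 1| / B) ^ 2 := by
    rw [← hd, dist_sq, ← abs_sub_sq hx, ← abs_sub_sq hy]
    field_simp
  have hPx : 0 < |P 0| / A := by positivity
  have hQx : 0 < |Q 0| / A := by positivity
  have hPy : 0 < |P 1| / B := by positivity
  have hQy : 0 < |Q 1| / B := by positivity
  rcases lt_trichotomy (|P 0| / A) (|Q 0| / A) with h | h | h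
  · exact not_integral_of_normalised hB hc hABc hsc ha hca hPx hPy hQy
      (normalise hP) (normalise hQ) h (hps ▸ hdF₁P) (hd ▸ hdPQ) hdd
      (hp ▸ hps) (hq ▸ hqs)
  · have hPn := normalise hP
    have hQn := normalise hQ
    have hyeq : |P 1| / B = |Q 1| / B := by
      rw [← sq_eq_sq₀ hPy.le hQy.le]
      rw [h] at hPn
      linarith
    rw [h, hyeq, ← hd] at hdd
    exact hPQ (dist_eq_zero.1 (pow_eq_zero_iff two_ne_zero |>.1 (hdd.trans (by ring))))
  · exact not_integral_of_normalised hB hc hABc hsc ha hca hQx hQy hPy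
      (normalise hQ) (normalise hP) h (hqs ▸ hdF₁Q) (hd ▸ hdPQ)
      (hdd.trans (by ring)) (hq ▸ hqs) (hp ▸ hps)
end

section
/- Let F₁ ≠ F₂ be two points of the Euclidean plane ℝ², and let S ⊆ ℝ² be a set of points such that no three points of S ∪ {F₁, F₂} are collinear and every p ∈ S is at positive integer distance from both F₁ and F₂. Then the simple graph on vertex set S in which distinct p, q ∈ S are adjacent if and only if dist(p, q) is an integer has finite chromatic number. -/
/-- Points `(x, y)` and `(x', y')` on one half of a branch of a conic with focus at the origin,
`x = α s + β` where `s` is the distance to the focus, are at a non-integer distance from each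
other once their distances `s < t` to the focus are distinct large integers. -/
theorem exists_forall_lt_dist_sq_ne_int_sq (α β : ℝ) (hα : α ^ 2 < 1) (hβ : β ≠ 0) :
    ∃ N : ℕ, ∀ s t : ℕ, N ≤ s → s < t → ∀ x y x' y' : ℝ, x = α * s + β → x' = α * t + β →
      x ^ 2 + y ^ 2 = (s : ℝ) ^ 2 → x' ^ 2 + y' ^ 2 = (t : ℝ) ^ 2 → 0 ≤ y * y' →
      ∀ n : ℤ, (x - x') ^ 2 + (y - y') ^ 2 ≠ (n : ℝ) ^ 2 := by
  obtain ⟨N, hN⟩ := exists_nat_gt ((2 * |α * β| + 2 * β ^ 2) / (1 - α ^ 2))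
  refine ⟨N + 1, fun s t hs hst x y x' y' hx hx' hxy hxy' hyy n hn => ?_⟩
  have h1 : 0 < 1 - α ^ 2 := by linarith
  rw [div_lt_iff₀ h1] at hN
  have hs' : (N : ℝ) + 1 ≤ s := by exact_mod_cast hs
  have hst' : (s : ℝ) + 1 ≤ t := by exact_mod_cast hst
  have hs1 : (1 : ℝ) ≤ s := by linarith [(Nat.cast_nonneg N : (0 : ℝ) ≤ N)]
  have hβ2 : 0 < β ^ 2 := by positivity
  have hsum : x * x' ≤ s * t - β ^ 2 * t := by
    have hlarge : 2 * |α * β| + 2 * β ^ 2 ≤ (1 - α ^ 2) * s := by nlinarith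
    have hlarge' := mul_le_mul_of_nonneg_right hlarge (by linarith : (0 : ℝ) ≤ t)
    have hcross : α * β * (s + t) ≤ |α * β| * (2 * t) :=
      mul_le_mul (le_abs_self _) (by linarith) (by linarith) (abs_nonneg _)
    have hsq : β ^ 2 * 1 ≤ β ^ 2 * t := mul_le_mul_of_nonneg_left (by linarith) hβ2.le
    rw [hx, hx']
    nlinarith
  set D := (s : ℝ) * t - x * x' - y * y' with hD
  set E := (s : ℝ) * t - x * x' + y * y' with hE
  have hDE : D * E = β ^ 2 * (t - s) ^ 2 := by
    have hy : y ^ 2 = s ^ 2 - x ^ 2 := by linarith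
    have hy' : y' ^ 2 = t ^ 2 - x' ^ 2 := by linarith
    calc D * E = (s * t - x * x') ^ 2 - y ^ 2 * y' ^ 2 := by rw [hD, hE]; ring
      _ = β ^ 2 * (t - s) ^ 2 := by rw [hy, hy', hx, hx']; ring
  have hEt : β ^ 2 * t ≤ E := by rw [hE]; linarith
  have hE0 : 0 < E := lt_of_lt_of_le (mul_pos hβ2 (by linarith)) hEt
  have hts : (0 : ℝ) < t - s := by linarith
  have hD0 : 0 < D := pos_of_mul_pos_left (hDE ▸ mul_pos hβ2 (pow_pos hts 2)) hE0.le
  have hDle : D ≤ t - s := by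
    refine le_of_mul_le_mul_right ?_ hE0
    have h2 : β ^ 2 * (t - s) ≤ E := le_trans (by nlinarith) hEt
    nlinarith
  have hdist : (n : ℝ) ^ 2 = (t - s) ^ 2 + 2 * D := by
    rw [← hn, hD]; linear_combination hxy + hxy'
  have hlt : (t : ℤ) - s < |n| := by
    have : (t : ℝ) - s < |(n : ℝ)| := lt_of_pow_lt_pow_left₀ 2 (abs_nonneg _) (by
      rw [sq_abs]; linarith)
    exact_mod_cast this
  have hgt : |n| < (t : ℤ) - s + 1 := by
    have : |(n : ℝ)| < (t : ℝ) - s + 1 := lt_of_pow_lt_pow_left₀ 2 (by linarith) (by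
      rw [sq_abs]; nlinarith)
    exact_mod_cast this
  omega

/-- Symmetric form of `exists_forall_lt_dist_sq_ne_int_sq`. -/
theorem exists_forall_dist_sq_ne_int_sq (α β : ℝ) (hα : α ^ 2 < 1) (hβ : β ≠ 0) :
    ∃ N : ℕ, ∀ s t : ℕ, N ≤ s → N ≤ t → s ≠ t → ∀ x y x' y' : ℝ,
      x = α * s + β → x' = α * t + β →
      x ^ 2 + y ^ 2 = (s : ℝ) ^ 2 → x' ^ 2 + y' ^ 2 = (t : ℝ) ^ 2 → 0 ≤ y * y' →
      ∀ n : ℤ, (x - x') ^ 2 + (y - y') ^ 2 ≠ (n : ℝ) ^ 2 := by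
  obtain ⟨N, hN⟩ := exists_forall_lt_dist_sq_ne_int_sq α β hα hβ
  refine ⟨N, fun s t hs ht hst x y x' y' hx hx' hxy hxy' hyy n hn => ?_⟩
  rcases lt_or_gt_of_ne hst with h | h
  · exact hN s t hs h x y x' y' hx hx' hxy hxy' hyy n hn
  · exact hN t s ht h x' y' x y hx' hx hxy' hxy (by linarith) n (by rw [← hn]; ring)

theorem SimpleGraph.chromaticNumber_lt_top_of_finite_range {V C : Type*} (G : SimpleGraph V)
    (f : V → C) (hf : (Set.range f).Finite) (h : ∀ v w, G.Adj v w → f v ≠ f w) :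
    G.chromaticNumber < ⊤ := by
  have := hf.fintype
  have c : G.Coloring (Set.range f) :=
    SimpleGraph.Coloring.mk (Set.rangeFactorization f) fun {v w} hvw heq =>
      h v w hvw (congrArg Subtype.val heq)
  exact lt_top_iff_ne_top.2
    (SimpleGraph.chromaticNumber_ne_top_iff_exists.2 ⟨_, c.colorable⟩)

/-- Coordinates in the frame centred at `F₁` whose first axis points towards `F₂`. -/
theorem exists_coordinates_of_ne (F₁ F₂ : EuclideanSpace ℝ (Fin 2)) (hF : F₁ ≠ F₂) :
    ∃ X Y : EuclideanSpace ℝ (Fin 2) → ℝ,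
      (∀ p q, (X p - X q) ^ 2 + (Y p - Y q) ^ 2 = dist p q ^ 2) ∧
      X F₁ = 0 ∧ Y F₁ = 0 ∧ X F₂ = dist F₁ F₂ ∧ Y F₂ = 0 ∧
      ∀ p, Y p = 0 → Collinear ℝ {p, F₁, F₂} := by
  have hd : dist F₁ F₂ ≠ 0 := dist_ne_zero.2 hF
  have hsq : ∀ p q : EuclideanSpace ℝ (Fin 2),
      dist p q ^ 2 = (p 0 - q 0) ^ 2 + (p 1 - q 1) ^ 2 := fun p q => by
    rw [EuclideanSpace.dist_eq, Real.sq_sqrt (by positivity)]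
    simp [Real.dist_eq, sq_abs]
  have hd2 := hsq F₁ F₂
  set d := dist F₁ F₂
  refine ⟨fun p => ((p 0 - F₁ 0) * (F₂ 0 - F₁ 0) + (p 1 - F₁ 1) * (F₂ 1 - F₁ 1)) / d,
    fun p => ((p 1 - F₁ 1) * (F₂ 0 - F₁ 0) - (p 0 - F₁ 0) * (F₂ 1 - F₁ 1)) / d,
    fun p q => ?_, by simp, by simp, ?_, ?_, fun p hp => ?_⟩
  · rw [hsq p q]
    field_simp
    rw [hd2]
    ring
  · field_simp
    rw [hd2]
    ring
  · ring
  · rw [collinear_iff_of_mem (p₀ := F₁) (by simp)]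
    refine ⟨F₂ - F₁, ?_⟩
    have hp' : (p 1 - F₁ 1) * (F₂ 0 - F₁ 0) - (p 0 - F₁ 0) * (F₂ 1 - F₁ 1) = 0 := by
      simpa [hd] using hp
    rintro q (rfl | rfl | rfl)
    · refine ⟨((q 0 - F₁ 0) * (F₂ 0 - F₁ 0) + (q 1 - F₁ 1) * (F₂ 1 - F₁ 1)) / d ^ 2, ?_⟩
      ext i
      fin_cases i
      · simp
        field_simp
        rw [hd2]
        linear_combination -(F₂ 1 - F₁ 1) * hp'
      · simp
        field_simp
        rw [hd2]
        linear_combination (F₂ 0 - F₁ 0) * hp'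
    · exact ⟨0, by simp⟩
    · exact ⟨1, by simp⟩

theorem common_neighbors_finite_chromatic (F₁ F₂ : EuclideanSpace ℝ (Fin 2))
    (hF : F₁ ≠ F₂) (S : Set (EuclideanSpace ℝ (Fin 2)))
    (hcol : ∀ x ∈ S ∪ {F₁, F₂}, ∀ y ∈ S ∪ {F₁, F₂}, ∀ z ∈ S ∪ {F₁, F₂},
        x ≠ y → y ≠ z → x ≠ z →
        ¬ Collinear ℝ ({x, y, z} : Set (EuclideanSpace ℝ (Fin 2))))
    (hdist : ∀ p ∈ S, (∃ n : ℕ, 1 ≤ n ∧ dist p F₁ = (n : ℝ)) ∧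
        (∃ n : ℕ, 1 ≤ n ∧ dist p F₂ = (n : ℝ))) :
    (SimpleGraph.fromRel
        (fun p q : S => ∃ n : ℤ, dist (p : EuclideanSpace ℝ (Fin 2)) (q : EuclideanSpace ℝ (Fin 2)) = (n : ℝ))).chromaticNumber < ⊤ := by
  obtain ⟨X, Y, hXY, hX₁, hY₁, hX₂, hY₂, hYcol⟩ := exists_coordinates_of_ne F₁ F₂ hF
  have hd : 0 < dist F₁ F₂ := dist_pos.2 hF
  have htri : ∀ p, |dist p F₁ - dist p F₂| ≤ dist F₁ F₂ := fun p => by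
    rw [dist_comm p F₁, dist_comm p F₂]
    exact abs_dist_sub_le F₁ F₂ p
  set d := dist F₁ F₂
  have hY : ∀ p ∈ S, Y p ≠ 0 := fun p hp h0 => by
    obtain ⟨⟨a, ha, hpa⟩, ⟨b, hb, hpb⟩⟩ := hdist p hp
    refine hcol p (by simp [hp]) F₁ (by simp) F₂ (by simp) ?_ hF ?_ (hYcol p h0)
    · rintro rfl
      rw [dist_self] at hpa
      norm_cast at hpa
      omega
    · rintro rfl
      rw [dist_self] at hpb
      norm_cast at hpb
      omega
  choose a ha using fun p : S => (hdist p p.2).1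
  choose b hb using fun p : S => (hdist p p.2).2
  let k : S → ℤ := fun p => a p - b p
  have hk : ∀ p, (k p : ℝ) = a p - b p := fun p => by simp [k]
  have hfocus : ∀ p : S, X p ^ 2 + Y p ^ 2 = (a p : ℝ) ^ 2 := fun p => by
    rw [← (ha p).2, ← hXY p F₁, hX₁, hY₁]
    ring
  have hX : ∀ p : S, X p = k p / d * a p + (d ^ 2 - k p ^ 2) / (2 * d) := fun p => by
    have h2 : (X p - d) ^ 2 + Y p ^ 2 = (b p : ℝ) ^ 2 := by
      rw [← (hb p).2, ← hXY p F₂, hX₂, hY₂]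
      ring
    have hbk : (b p : ℝ) = a p - k p := by rw [hk]; ring
    rw [hbk] at h2
    field_simp
    linear_combination hfocus p - h2
  have hkd : ∀ p : S, |(k p : ℝ)| ≤ d := fun p => by
    rw [hk, ← (ha p).2, ← (hb p).2]
    exact htri p
  have hklt : ∀ p : S, (k p : ℝ) ^ 2 < d ^ 2 := fun p => by
    refine lt_of_le_of_ne (sq_le_sq' (abs_le.1 (hkd p)).1 (abs_le.1 (hkd p)).2) fun heq => ?_
    have hXp := hX p
    have hXsq : X p ^ 2 = (a p : ℝ) ^ 2 := by
      rw [hXp, heq, sub_self, zero_div, add_zero, mul_pow, div_pow, heq,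
        div_self (by positivity), one_mul]
    exact hY p p.2 (pow_eq_zero_iff two_ne_zero |>.1 (by linarith [hfocus p]))
  have hN : ∀ j : ℤ, ∃ N : ℕ, (j : ℝ) ^ 2 < d ^ 2 → ∀ s t : ℕ, N ≤ s → N ≤ t → s ≠ t →
      ∀ x y x' y' : ℝ, x = j / d * s + (d ^ 2 - j ^ 2) / (2 * d) →
      x' = j / d * t + (d ^ 2 - j ^ 2) / (2 * d) →
      x ^ 2 + y ^ 2 = (s : ℝ) ^ 2 → x' ^ 2 + y' ^ 2 = (t : ℝ) ^ 2 → 0 ≤ y * y' →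
      ∀ n : ℤ, (x - x') ^ 2 + (y - y') ^ 2 ≠ (n : ℝ) ^ 2 := fun j => by
    by_cases hj : (j : ℝ) ^ 2 < d ^ 2
    · obtain ⟨N, hN⟩ := exists_forall_dist_sq_ne_int_sq (j / d) ((d ^ 2 - j ^ 2) / (2 * d))
        (by rw [div_pow, div_lt_one (by positivity)]; exact hj)
        (div_ne_zero (by linarith) (by positivity))
      exact ⟨N, fun _ => hN⟩
    · exact ⟨0, fun h => absurd h hj⟩
  choose N hN using hN
  refine SimpleGraph.chromaticNumber_lt_top_of_finite_range _
    (fun p : S => (k p, decide (0 < Y p), min (a p) (N (k p)))) ?_ ?_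
  · have hfin : (⋃ j ∈ Set.Icc (-⌊d⌋) ⌊d⌋,
        ({j} ×ˢ (Set.univ ×ˢ Set.Iic (N j)) : Set (ℤ × Bool × ℕ))).Finite :=
      (Set.finite_Icc _ _).biUnion fun j _ =>
        (Set.finite_singleton j).prod (Set.finite_univ.prod (Set.finite_Iic _))
    refine hfin.subset ?_
    rintro _ ⟨p, rfl⟩
    have hkp : |k p| ≤ ⌊d⌋ := Int.le_floor.2 (by push_cast; exact hkd p)
    simp only [Set.mem_iUnion]
    exact ⟨k p, abs_le.1 hkp, rfl, trivial, Set.mem_Iic.2 (min_le_right _ _)⟩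
  · intro p q hpq heq
    rw [SimpleGraph.fromRel_adj] at hpq
    obtain ⟨hne, hint⟩ := hpq
    obtain ⟨n, hn⟩ : ∃ n : ℤ, dist (p : EuclideanSpace ℝ (Fin 2)) q = n := by
      rcases hint with h | h
      · exact h
      · rwa [dist_comm]
    simp only [Prod.mk.injEq, decide_eq_decide] at heq
    obtain ⟨hkk, hsign, hmin⟩ := heq
    have hyy : 0 < Y p * Y q := by
      rcases lt_or_gt_of_ne (hY p p.2) with h | h
      · have hq : Y q < 0 := lt_of_le_of_ne (not_lt.1 fun h' => h.not_gt (hsign.2 h')) (hY q q.2)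
        exact mul_pos_of_neg_of_neg h hq
      · exact mul_pos h (hsign.1 h)
    have hXq := hX q
    rw [← hkk] at hXq hmin
    have hapq : a p ≠ a q := fun h => by
      have hXeq : X p = X q := by rw [hX p, hXq, h]
      have hYeq : Y p = Y q := by
        have hsq : Y p ^ 2 = Y q ^ 2 := by
          have h1 := hfocus p
          rw [h, hXeq] at h1
          linarith [hfocus q]
        rcases sq_eq_sq_iff_eq_or_eq_neg.1 hsq with h' | h'
        · exact h'
        · rw [h'] at hyy
          nlinarith [sq_nonneg (Y q)]
      have h0 := hXY p q
      rw [hXeq, hYeq] at h0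
      exact hne (Subtype.ext (dist_eq_zero.1 (pow_eq_zero_iff two_ne_zero |>.1 (by linarith))))
    exact hN (k p) (hklt p) (a p) (a q) (by omega) (by omega) hapq (X p) (Y p) (X q) (Y q)
      (hX p) hXq (hfocus p) (hfocus q) hyy.le n (by rw [hXY, hn])
end

section
/- Let G be a simple graph with two distinct vertices v and w such that the subgraph of G induced on the set of common neighbors of v and w has infinite chromatic number, i.e. admits no proper coloring with finitely many colors. Then G has no integral realization. -/
open Filter

/-- A half-branch of a hyperbola with foci `(0, 0)` and `(d, 0)`, parametrised by the distance `a`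
to the first focus, approaches its asymptote. -/
lemma exists_hyperbola_asymptote {d k : ℝ} (hd : 0 < d) (hk : |k| ≤ d) :
    ∃ s h : ℝ, s ^ 2 = 1 - (k / d) ^ 2 ∧ ∀ᶠ a : ℝ in atTop, ∀ x y : ℝ, 0 ≤ y →
      x ^ 2 + y ^ 2 = a ^ 2 → (x - d) ^ 2 + y ^ 2 = (a - k) ^ 2 → |y - s * (a - h)| < 1 / 2 := by
  have hkd : 0 ≤ 1 - (k / d) ^ 2 := by
    have : (k / d) ^ 2 ≤ 1 := by
      rw [sq_le_one_iff_abs_le_one, abs_div, abs_of_pos hd]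
      exact (div_le_one hd).2 hk
    linarith
  obtain ⟨s, hs0, hs⟩ : ∃ s : ℝ, 0 ≤ s ∧ s ^ 2 = 1 - (k / d) ^ 2 :=
    ⟨√(1 - (k / d) ^ 2), Real.sqrt_nonneg _, Real.sq_sqrt hkd⟩
  have hx : ∀ {a x y : ℝ}, x ^ 2 + y ^ 2 = a ^ 2 → (x - d) ^ 2 + y ^ 2 = (a - k) ^ 2 →
      x = k / d * a + (d ^ 2 - k ^ 2) / (2 * d) := by
    intro a x y h₁ h₂
    field_simp
    linarith
  have hd2 : d ^ 2 - k ^ 2 = d ^ 2 * s ^ 2 := by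
    rw [hs]
    field_simp
  rcases hs0.eq_or_lt with rfl | hspos
  · refine ⟨0, 0, hs, Eventually.of_forall fun a x y _ h₁ h₂ => ?_⟩
    have hxa := hx h₁ h₂
    rw [hd2] at hxa
    have : y ^ 2 = 0 := by
      have hk1 : (k / d) ^ 2 = 1 := by linarith
      have : x ^ 2 = a ^ 2 := by
        rw [hxa]
        linear_combination a ^ 2 * hk1
      linarith
    simp [pow_eq_zero_iff two_ne_zero |>.1 this]
  · refine ⟨s, k / 2, hs, ?_⟩
    set m : ℝ := s * (d ^ 2 / 4) with hm
    have hm0 : 0 ≤ m := by positivity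
    filter_upwards [eventually_gt_atTop (k / 2 + (2 * m + 1))] with a ha x y hy h₁ h₂
    have hxa := hx h₁ h₂
    rw [hd2] at hxa
    have ht : 2 * m < a - k / 2 := by linarith
    have ht0 : 0 < a - k / 2 := by linarith
    have hyy : y ^ 2 = s ^ 2 * (a - k / 2) ^ 2 - s ^ 2 * (d ^ 2 / 4) := by
      have hkk : k ^ 2 = d ^ 2 - d ^ 2 * s ^ 2 := by linarith
      have hxa' : x = k / d * a + d * s ^ 2 / 2 := by
        rw [hxa]
        field_simp
      have hkd2 : (k / d) ^ 2 = 1 - s ^ 2 := by linarith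
      have hkd3 : k / d * d = k := by field_simp
      have : y ^ 2 = a ^ 2 - x ^ 2 := by linarith
      rw [this, hxa']
      linear_combination (-a ^ 2) * hkd2 - a * s ^ 2 * hkd3 - s ^ 2 / 4 * hkk
    have hprod : (s * (a - k / 2) - y) * (s * (a - k / 2) + y) = s * m := by
      rw [hm]
      linear_combination -hyy
    have hst : 0 < s * (a - k / 2) := mul_pos hspos ht0
    rw [abs_lt]
    constructor
    · by_contra! hcon
      nlinarith [mul_lt_mul_of_pos_left ht hspos]
    · by_contra! hcon
      nlinarith [mul_nonneg hspos.le hm0]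

/-- Far out on a half-branch of a hyperbola, the distance between two points exceeds the difference
of their distances to a focus by less than one. -/
lemma sq_add_sq_lt_of_hyperbola {d k : ℝ} (hd : 0 < d) (hk : |k| ≤ d) :
    ∀ᶠ N : ℝ in atTop, ∀ a₁ a₂ x₁ x₂ y₁ y₂ : ℝ, N ≤ a₁ → N ≤ a₂ → 0 ≤ y₁ → 0 ≤ y₂ →
      x₁ ^ 2 + y₁ ^ 2 = a₁ ^ 2 → (x₁ - d) ^ 2 + y₁ ^ 2 = (a₁ - k) ^ 2 →
      x₂ ^ 2 + y₂ ^ 2 = a₂ ^ 2 → (x₂ - d) ^ 2 + y₂ ^ 2 = (a₂ - k) ^ 2 →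
      (x₁ - x₂) ^ 2 + (y₁ - y₂) ^ 2 < (|a₁ - a₂| + 1) ^ 2 := by
  obtain ⟨s, h, hs, hev⟩ := exists_hyperbola_asymptote hd hk
  filter_upwards [eventually_forall_ge_atTop.2 hev]
    with N hN a₁ a₂ x₁ x₂ y₁ y₂ hN₁ hN₂ hy₁ hy₂ h₁ h₁' h₂ h₂'
  have hδ : |(y₁ - y₂) - s * (a₁ - a₂)| < 1 := by
    have e₁ := abs_lt.1 (hN a₁ hN₁ x₁ y₁ hy₁ h₁ h₁')
    have e₂ := abs_lt.1 (hN a₂ hN₂ x₂ y₂ hy₂ h₂ h₂')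
    rw [abs_lt]
    constructor <;> linarith [e₁.1, e₁.2, e₂.1, e₂.2]
  obtain ⟨δ, hδ'⟩ : ∃ δ, δ = (y₁ - y₂) - s * (a₁ - a₂) := ⟨_, rfl⟩
  rw [← hδ'] at hδ
  have hx : x₁ - x₂ = k / d * (a₁ - a₂) := by
    field_simp
    linarith
  have hy : y₁ - y₂ = s * (a₁ - a₂) + δ := by linarith
  have hs1 : |s| ≤ 1 := by
    rw [← sq_le_one_iff_abs_le_one, hs]
    linarith [sq_nonneg (k / d)]
  have hcross : s * (a₁ - a₂) * δ ≤ |a₁ - a₂| := by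
    calc s * (a₁ - a₂) * δ ≤ |s * (a₁ - a₂) * δ| := le_abs_self _
      _ = |s| * |a₁ - a₂| * |δ| := by rw [abs_mul, abs_mul]
      _ ≤ 1 * |a₁ - a₂| * 1 := by gcongr
      _ = |a₁ - a₂| := by ring
  have hδ2 : δ ^ 2 < 1 := (sq_lt_one_iff_abs_lt_one δ).2 hδ
  have habs := sq_abs (a₁ - a₂)
  rw [hx, hy]
  nlinarith [congrArg (· * (a₁ - a₂) ^ 2) hs]

/-- Cartesian coordinates on the Euclidean plane with `P` at the origin and `Q` on the positive
first axis. -/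
lemma exists_coordinates {P Q : EuclideanSpace ℝ (Fin 2)} (hPQ : P ≠ Q) :
    ∃ X Y : EuclideanSpace ℝ (Fin 2) → ℝ,
      (∀ R S, dist R S ^ 2 = (X R - X S) ^ 2 + (Y R - Y S) ^ 2) ∧
      X P = 0 ∧ Y P = 0 ∧ X Q = dist P Q ∧ Y Q = 0 := by
  have hd : 0 < dist P Q := dist_pos.2 hPQ
  have hdist : ∀ R S : EuclideanSpace ℝ (Fin 2),
      dist R S ^ 2 = (R 0 - S 0) ^ 2 + (R 1 - S 1) ^ 2 := by
    intro R S
    rw [EuclideanSpace.dist_eq, Real.sq_sqrt (by positivity)]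
    simp [Fin.sum_univ_two, Real.dist_eq, sq_abs]
  have hd2 := hdist P Q
  refine ⟨fun R => ((R 0 - P 0) * (Q 0 - P 0) + (R 1 - P 1) * (Q 1 - P 1)) / dist P Q,
    fun R => ((R 1 - P 1) * (Q 0 - P 0) - (R 0 - P 0) * (Q 1 - P 1)) / dist P Q,
    fun R S => ?_, by simp, by simp, ?_, ?_⟩
  · rw [hdist R S]
    simp only [← sub_div, div_pow, ← add_div]
    rw [eq_div_iff (by positivity), hd2]
    ring
  · simp only
    rw [div_eq_iff hd.ne']
    linarith
  · simp only
    rw [div_eq_zero_iff]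
    left
    ring

theorem no_integral_realization_of_infinite_chromatic_common_neighbors
    {V : Type*} (G : SimpleGraph V) (v w : V) (hvw : v ≠ w)
    (hchrom : ∀ n : ℕ,
        ¬ (G.induce {u : V | G.Adj v u ∧ G.Adj w u}).Colorable n) :
    ¬ ∃ f : V → EuclideanSpace ℝ (Fin 2), IsIntegralRealization G f := by
  rintro ⟨f, hinj, hcol, hadj⟩
  obtain ⟨X, Y, hXY, hXv, hYv, hXw, hYw⟩ := exists_coordinates (hinj.ne hvw)
  set d := dist (f v) (f w)
  have hd : 0 < d := dist_pos.2 (hinj.ne hvw)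
  have ha : ∀ u : {u : V | G.Adj v u ∧ G.Adj w u}, ∃ a : ℤ, dist (f u) (f v) = a := fun u =>
    (hadj u v u.2.1.ne').1 u.2.1.symm
  have hb : ∀ u : {u : V | G.Adj v u ∧ G.Adj w u}, ∃ b : ℤ, dist (f u) (f w) = b := fun u =>
    (hadj u w u.2.2.ne').1 u.2.2.symm
  choose a ha using ha
  choose b hb using hb
  have hab : ∀ u, |((a u - b u : ℤ) : ℝ)| ≤ d := by
    intro u
    rw [Int.cast_sub, ← ha, ← hb, dist_comm (f u), dist_comm (f u)]
    exact abs_dist_sub_le _ _ _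
  have hmem : ∀ u, a u - b u ∈ Finset.Icc (-⌊d⌋) ⌊d⌋ := by
    intro u
    rw [Finset.mem_Icc, ← abs_le, Int.le_floor, Int.cast_abs]
    exact hab u
  have hfar : ∀ᶠ N : ℝ in atTop, ∀ k ∈ Finset.Icc (-⌊d⌋) ⌊d⌋,
      ∀ a₁ a₂ x₁ x₂ y₁ y₂ : ℝ, N ≤ a₁ → N ≤ a₂ → 0 ≤ y₁ → 0 ≤ y₂ →
      x₁ ^ 2 + y₁ ^ 2 = a₁ ^ 2 → (x₁ - d) ^ 2 + y₁ ^ 2 = (a₁ - k) ^ 2 →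
      x₂ ^ 2 + y₂ ^ 2 = a₂ ^ 2 → (x₂ - d) ^ 2 + y₂ ^ 2 = (a₂ - k) ^ 2 →
      (x₁ - x₂) ^ 2 + (y₁ - y₂) ^ 2 < (|a₁ - a₂| + 1) ^ 2 := by
    refine (Filter.eventually_all_finset _).2 fun k hk => sq_add_sq_lt_of_hyperbola hd ?_
    rwa [Finset.mem_Icc, ← abs_le, Int.le_floor, Int.cast_abs] at hk
  obtain ⟨N, hN⟩ := (tendsto_natCast_atTop_atTop.eventually hfar).exists
  let color : {u : V | G.Adj v u ∧ G.Adj w u} →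
      Fin (N + 1) × Finset.Icc (-⌊d⌋) ⌊d⌋ × Prop := fun u =>
    (⟨min (a u).toNat N, by omega⟩, ⟨a u - b u, hmem u⟩, 0 ≤ Y (f u))
  refine hchrom _ (SimpleGraph.Coloring.mk color ?_).colorable
  intro p q hpq hc
  rw [SimpleGraph.comap_adj] at hpq
  simp only [color, Prod.mk.injEq, Fin.mk.injEq, Subtype.mk.injEq, eq_iff_iff] at hc
  obtain ⟨hmin, hk, hside⟩ := hc
  have hpv := hXY (f p) (f v)
  have hqv := hXY (f q) (f v)
  have hpw := hXY (f p) (f w)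
  have hqw := hXY (f q) (f w)
  rw [ha, hXv, hYv, sub_zero, sub_zero, ← sq_abs (Y _)] at hpv hqv
  rw [hb, hXw, hYw, sub_zero, ← sq_abs (Y _)] at hpw hqw
  have hbp : (b p : ℝ) = a p - (a p - b p : ℤ) := by push_cast; ring
  have hbq : (b q : ℝ) = a q - (a p - b p : ℤ) := by rw [hk]; push_cast; ring
  rw [hbp] at hpw
  rw [hbq] at hqw
  have hYY : (Y (f p) - Y (f q)) ^ 2 = (|Y (f p)| - |Y (f q)|) ^ 2 := by
    by_cases h : 0 ≤ Y (f p)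
    · rw [abs_of_nonneg h, abs_of_nonneg (hside.1 h)]
    · rw [abs_of_neg (not_le.1 h), abs_of_neg (not_le.1 fun h' => h (hside.2 h'))]
      ring
  have hpq_dist := hXY (f p) (f q)
  rw [hYY] at hpq_dist
  obtain ⟨D, hD⟩ := (hadj p q hpq.ne).1 hpq
  have hpos : 0 < dist (f p) (f q) := dist_pos.2 (hinj.ne hpq.ne)
  have hap : 0 ≤ a p := by exact_mod_cast (ha p) ▸ dist_nonneg
  have haq : 0 ≤ a q := by exact_mod_cast (ha q) ▸ dist_nonneg
  by_cases haa : a p = a q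
  · rw [haa] at hpv hpw
    have hX : X (f p) = X (f q) := by
      refine mul_left_cancel₀ hd.ne' ?_
      rw [haa] at hqw
      linarith
    have hY : |Y (f p)| = |Y (f q)| := by
      rw [hX] at hpv
      exact (sq_eq_sq₀ (abs_nonneg _) (abs_nonneg _)).1 (by linarith)
    rw [hX, hY] at hpq_dist
    nlinarith
  · have hNp : (N : ℝ) ≤ a p := by exact_mod_cast (show (N : ℤ) ≤ a p by omega)
    have hNq : (N : ℝ) ≤ a q := by exact_mod_cast (show (N : ℤ) ≤ a q by omega)
    have hlt := hN _ (hmem p) _ _ _ _ _ _ hNp hNq (abs_nonneg _) (abs_nonneg _)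
      hpv.symm hpw.symm hqv.symm hqw.symm
    rw [← hpq_dist] at hlt
    have hlt' : dist (f p) (f q) < |(a p : ℝ) - a q| + 1 :=
      lt_of_pow_lt_pow_left₀ 2 (by positivity) hlt
    have hge : |(a p : ℝ) - a q| ≤ dist (f p) (f q) := by
      rw [← ha, ← ha]
      exact abs_dist_sub_le _ _ _
    have hDeq : dist (f p) (f q) = |(a p : ℝ) - a q| := by
      rw [hD] at hlt' hge ⊢
      norm_cast at hlt' hge ⊢
      omega
    have hvp : f v ≠ f p := hinj.ne p.2.1.ne
    have hvq : f v ≠ f q := hinj.ne q.2.1.ne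
    have hpq' : f p ≠ f q := hinj.ne hpq.ne
    rcases abs_cases ((a p : ℝ) - a q) with h | h
    · refine hcol (f v) (f q) (f p) ⟨v, rfl⟩ ⟨q, rfl⟩ ⟨p, rfl⟩ hvq hpq'.symm hvp
        (dist_add_dist_eq_iff.1 ?_).collinear
      rw [dist_comm (f v), dist_comm (f v), dist_comm (f q) (f p), hDeq, h.1, ha, ha]
      ring
    · refine hcol (f v) (f p) (f q) ⟨v, rfl⟩ ⟨p, rfl⟩ ⟨q, rfl⟩ hvp hpq' hvq
        (dist_add_dist_eq_iff.1 ?_).collinear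
      rw [dist_comm (f v), dist_comm (f v), hDeq, h.1, ha, ha]
      ring
end

section
/- There exists a simple graph G on vertex set ℕ that has no integral realization. -/
/-- Three points of the plane whose difference vectors have zero determinant are collinear. -/
lemma collinear_of_det_eq_zero {p q r : EuclideanSpace ℝ (Fin 2)} (hpq : p ≠ q)
    (h : (q 0 - p 0) * (r 1 - p 1) - (q 1 - p 1) * (r 0 - p 0) = 0) :
    Collinear ℝ ({p, q, r} : Set (EuclideanSpace ℝ (Fin 2))) := by
  have hpos : (q 0 - p 0) ^ 2 + (q 1 - p 1) ^ 2 ≠ 0 := by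
    intro h0
    apply hpq
    ext i
    fin_cases i
    · simp only [Fin.zero_eta]
      nlinarith [sq_nonneg (q 0 - p 0), sq_nonneg (q 1 - p 1)]
    · simp only [Fin.mk_one]
      nlinarith [sq_nonneg (q 0 - p 0), sq_nonneg (q 1 - p 1)]
  rw [collinear_iff_of_mem (p₀ := p) (by simp)]
  refine ⟨q - p, ?_⟩
  simp only [Set.mem_insert_iff, Set.mem_singleton_iff, forall_eq_or_imp, forall_eq]
  refine ⟨⟨0, by simp⟩, ⟨1, by simp⟩,
    ⟨((q 0 - p 0) * (r 0 - p 0) + (q 1 - p 1) * (r 1 - p 1)) /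
      ((q 0 - p 0) ^ 2 + (q 1 - p 1) ^ 2), ?_⟩⟩
  ext i
  fin_cases i
  · simp only [Fin.zero_eta, vadd_eq_add, PiLp.add_apply, PiLp.smul_apply, PiLp.sub_apply,
      smul_eq_mul]
    field_simp
    linear_combination (-(q 1 - p 1)) * h
  · simp only [Fin.mk_one, vadd_eq_add, PiLp.add_apply, PiLp.smul_apply, PiLp.sub_apply,
      smul_eq_mul]
    field_simp
    linear_combination (q 0 - p 0) * h

lemma dist_sq_eq (p q : EuclideanSpace ℝ (Fin 2)) :
    dist p q ^ 2 = (p 0 - q 0) ^ 2 + (p 1 - q 1) ^ 2 := by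
  rw [EuclideanSpace.dist_sq_eq]
  simp [Fin.sum_univ_two, Real.dist_eq]

/-- If `p` and `q` have the same difference of distances to `a` and `b`, then the inner product
of `p - q` with `b - a` is that difference times the difference of their distances to `a`. -/
lemma inner_sub_of_dist_sub_dist {a b p q : EuclideanSpace ℝ (Fin 2)} {k : ℝ}
    (hp : dist p a - dist p b = k) (hq : dist q a - dist q b = k) :
    (p 0 - q 0) * (b 0 - a 0) + (p 1 - q 1) * (b 1 - a 1) = k * (dist p a - dist q a) := by
  have hpb : dist p b = dist p a - k := by linarith
  have hqb : dist q b = dist q a - k := by linarith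
  have h₁ := dist_sq_eq p a
  have h₂ := dist_sq_eq p b
  have h₃ := dist_sq_eq q a
  have h₄ := dist_sq_eq q b
  rw [hpb] at h₂
  rw [hqb] at h₄
  linear_combination (h₂ - h₁ + h₃ - h₄) / 2

/-- Points with prescribed differences of distances to three non-collinear points lie on a line. -/
lemma collinear_of_dist_sub_dist {a b c p q r : EuclideanSpace ℝ (Fin 2)} {k l : ℝ}
    (habc : ¬ Collinear ℝ ({a, b, c} : Set (EuclideanSpace ℝ (Fin 2)))) (hab : a ≠ b)
    (hpq : p ≠ q)
    (hpb : dist p a - dist p b = k) (hpc : dist p a - dist p c = l)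
    (hqb : dist q a - dist q b = k) (hqc : dist q a - dist q c = l)
    (hrb : dist r a - dist r b = k) (hrc : dist r a - dist r c = l) :
    Collinear ℝ ({p, q, r} : Set (EuclideanSpace ℝ (Fin 2))) := by
  have hdet : (b 0 - a 0) * (c 1 - a 1) - (b 1 - a 1) * (c 0 - a 0) ≠ 0 :=
    fun h => habc (collinear_of_det_eq_zero hab h)
  have h₁ := inner_sub_of_dist_sub_dist hqb hpb
  have h₂ := inner_sub_of_dist_sub_dist hqc hpc
  have h₃ := inner_sub_of_dist_sub_dist hrb hpb
  have h₄ := inner_sub_of_dist_sub_dist hrc hpc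
  apply collinear_of_det_eq_zero hpq
  apply (mul_eq_zero.mp _).resolve_right hdet
  linear_combination
    ((r 0 - p 0) * (c 0 - a 0) + (r 1 - p 1) * (c 1 - a 1)) * h₁
    + k * (dist q a - dist p a) * h₄
    - ((r 0 - p 0) * (b 0 - a 0) + (r 1 - p 1) * (b 1 - a 1)) * h₂
    - l * (dist q a - dist p a) * h₃

lemma dist_sub_dist_mem_Icc {X : Type*} [PseudoMetricSpace X] {a b p : X} {m n N : ℤ}
    (hm : dist p a = m) (hn : dist p b = n) (hN : dist a b = N) :
    m - n ∈ Set.Icc (-N) N := by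
  have h₁ := dist_triangle p a b
  have h₂ := dist_triangle p b a
  rw [dist_comm b a] at h₂
  rw [hm, hn, hN] at h₁ h₂
  norm_cast at h₁ h₂
  constructor <;> omega

/-- The Anning–Erdős theorem for points in general position: no infinite set in general position
has only integer distances, so the complete graph has no integral realization. -/
lemma not_isIntegralRealization_top (f : ℕ → EuclideanSpace ℝ (Fin 2)) :
    ¬ IsIntegralRealization (⊤ : SimpleGraph ℕ) f := by
  rintro ⟨hinj, hcol, hadj⟩
  have hint (u v : ℕ) : ∃ n : ℤ, dist (f u) (f v) = n := by
    by_cases huv : u = v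
    · exact ⟨0, by simp [huv]⟩
    · exact (hadj u v huv).mp (by simpa using huv)
  have hcol' {u v w : ℕ} (huv : u ≠ v) (hvw : v ≠ w) (huw : u ≠ w) :
      ¬ Collinear ℝ ({f u, f v, f w} : Set (EuclideanSpace ℝ (Fin 2))) :=
    hcol _ _ _ ⟨u, rfl⟩ ⟨v, rfl⟩ ⟨w, rfl⟩ (hinj.ne huv) (hinj.ne hvw) (hinj.ne huw)
  choose d hd using hint
  let g (n : ℕ) : Set.Icc (-d 0 1) (d 0 1) × Set.Icc (-d 0 2) (d 0 2) :=
    (⟨d n 0 - d n 1, dist_sub_dist_mem_Icc (hd n 0) (hd n 1) (hd 0 1)⟩,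
      ⟨d n 0 - d n 2, dist_sub_dist_mem_Icc (hd n 0) (hd n 2) (hd 0 2)⟩)
  obtain ⟨y, hy⟩ := Finite.exists_infinite_fiber g
  obtain ⟨t, ht, htc⟩ := (Set.infinite_coe_iff.mp hy).exists_subset_card_eq 3
  obtain ⟨u, v, w, huv, huw, hvw, rfl⟩ := Finset.card_eq_three.mp htc
  have key (n : ℕ) (hn : n ∈ ({u, v, w} : Finset ℕ)) :
      dist (f n) (f 0) - dist (f n) (f 1) = (y.1 : ℤ) ∧
        dist (f n) (f 0) - dist (f n) (f 2) = (y.2 : ℤ) := by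
    have hgn : g n = y := ht hn
    rw [← hgn, hd, hd, hd]
    simp [g]
  obtain ⟨hu₁, hu₂⟩ := key u (by simp)
  obtain ⟨hv₁, hv₂⟩ := key v (by simp)
  obtain ⟨hw₁, hw₂⟩ := key w (by simp)
  exact hcol' huv hvw huw (collinear_of_dist_sub_dist
    (hcol' (u := 0) (v := 1) (w := 2) (by simp) (by simp) (by simp)) (hinj.ne (by simp))
    (hinj.ne huv) hu₁ hu₂ hv₁ hv₂ hw₁ hw₂)

theorem exists_non_integral_graph :
    ∃ G : SimpleGraph ℕ,
      ¬ ∃ f : ℕ → EuclideanSpace ℝ (Fin 2), IsIntegralRealization G f :=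
  ⟨⊤, fun ⟨f, hf⟩ => not_isIntegralRealization_top f hf⟩
end

section
/- There exists a simple graph G on vertex set ℕ such that every vertex of G has finite degree, G has infinite chromatic number (for every finite k, G admits no proper k-coloring), and G has no integral realization. -/
/-- If `P` is joined to a nondegenerate triangle of diameter at most `d` by integer distances
`r`, `s`, `t` (satisfying the Cayley-Menger relation), then `r ≤ 4 * d ^ 6`, because `r` divides
the constant term of that relation. -/
theorem le_of_cayleyMenger_eq_zero {a b c r s t d : ℤ}
    (hb : b ≤ d) (hc : c ≤ d)
    (habc : a < b + c) (hbac : b < a + c) (hcab : c < a + b)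
    (hrs : r < s + b) (hsr : s < r + b) (hrt : r < t + c) (htr : t < r + c)
    (hCM : r ^ 2 * (4 * b ^ 2 * c ^ 2 - (b ^ 2 + c ^ 2 - a ^ 2) ^ 2) =
      c ^ 2 * (b ^ 2 + r ^ 2 - s ^ 2) ^ 2
        - (b ^ 2 + c ^ 2 - a ^ 2) * (b ^ 2 + r ^ 2 - s ^ 2) * (c ^ 2 + r ^ 2 - t ^ 2)
        + b ^ 2 * (c ^ 2 + r ^ 2 - t ^ 2) ^ 2) :
    r ≤ 4 * d ^ 6 := by
  have hb0 : 0 < b := by linarith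
  have hc0 : 0 < c := by linarith
  have hd0 : 0 < d := by linarith
  obtain ⟨k, rfl⟩ : ∃ k, s = r - k := ⟨r - s, by ring⟩
  obtain ⟨l, rfl⟩ : ∃ l, t = r - l := ⟨r - t, by ring⟩
  obtain ⟨g, hg⟩ : ∃ g, g = b ^ 2 + c ^ 2 - a ^ 2 := ⟨_, rfl⟩
  obtain ⟨β, hβ⟩ : ∃ β, β = b ^ 2 - k ^ 2 := ⟨_, rfl⟩
  obtain ⟨γ, hγ⟩ : ∃ γ, γ = c ^ 2 - l ^ 2 := ⟨_, rfl⟩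
  have hβ0 : 0 < β := by
    have := mul_pos (show 0 < b - k by linarith) (show 0 < b + k by linarith)
    linarith
  have hγ0 : 0 < γ := by
    have := mul_pos (show 0 < c - l by linarith) (show 0 < c + l by linarith)
    linarith
  have hg1 : g < 2 * b * c := by
    have := mul_pos (show 0 < a - b + c by linarith) (show 0 < a + b - c by linarith)
    linarith
  have hg2 : -(2 * b * c) < g := by
    have := mul_pos (show 0 < b + c - a by linarith) (show 0 < b + c + a by linarith)
    linarith
  have hbd : b ^ 2 ≤ d ^ 2 := by gcongr
  have hcd : c ^ 2 ≤ d ^ 2 := by gcongr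
  have hβd : β ≤ d ^ 2 := by linarith [sq_nonneg k]
  have hγd : γ ≤ d ^ 2 := by linarith [sq_nonneg l]
  have hbc : b * c ≤ d ^ 2 := by linarith [sq_nonneg (b - c)]
  have hpos : 0 < c ^ 2 * β ^ 2 - g * β * γ + b ^ 2 * γ ^ 2 := by
    have h1 : 0 < (2 * b * c - g) * (β * γ) := mul_pos (by linarith) (mul_pos hβ0 hγ0)
    linarith [sq_nonneg (c * β - b * γ)]
  have hle : c ^ 2 * β ^ 2 - g * β * γ + b ^ 2 * γ ^ 2 ≤ 4 * d ^ 6 := by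
    have h1 : c ^ 2 * β ^ 2 ≤ d ^ 2 * (d ^ 2) ^ 2 := by gcongr
    have h2 : b ^ 2 * γ ^ 2 ≤ d ^ 2 * (d ^ 2) ^ 2 := by gcongr
    have h3 : -g * (β * γ) ≤ (2 * d ^ 2) * (d ^ 2 * d ^ 2) := by
      calc -g * (β * γ) ≤ (2 * d ^ 2) * (β * γ) := by
            gcongr
            linarith
        _ ≤ _ := by gcongr
    linarith
  have hdvd : r ∣ c ^ 2 * β ^ 2 - g * β * γ + b ^ 2 * γ ^ 2 := by
    refine ⟨r * (4 * b ^ 2 * c ^ 2 - g ^ 2)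
      - (4 * c ^ 2 * k * (β + r * k) - 2 * g * (β * l + γ * k + 2 * r * k * l)
        + 4 * b ^ 2 * l * (γ + r * l)), ?_⟩
    rw [← hg] at hCM
    rw [hβ, hγ]
    linear_combination -hCM
  exact (Int.le_of_dvd hpos hdvd).trans hle

theorem EuclideanSpace.dist_sq_eq_fin_two (x y : EuclideanSpace ℝ (Fin 2)) :
    dist x y ^ 2 = (x 0 - y 0) ^ 2 + (x 1 - y 1) ^ 2 := by
  rw [EuclideanSpace.dist_eq, Real.sq_sqrt (by positivity)]
  simp [Real.dist_eq, sq_abs]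

theorem dist_lt_dist_add_dist_of_not_collinear_s12 {x y z : EuclideanSpace ℝ (Fin 2)}
    (h : ¬ Collinear ℝ ({x, y, z} : Set (EuclideanSpace ℝ (Fin 2)))) :
    dist x z < dist x y + dist y z :=
  (dist_triangle x y z).lt_of_ne fun he => h (dist_add_dist_eq_iff.1 he.symm).collinear

theorem dist_le_of_integral_triangle {A B C P : EuclideanSpace ℝ (Fin 2)} {d : ℕ}
    (hABC : ¬ Collinear ℝ ({A, B, C} : Set (EuclideanSpace ℝ (Fin 2))))
    (hABP : ¬ Collinear ℝ ({A, B, P} : Set (EuclideanSpace ℝ (Fin 2))))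
    (hACP : ¬ Collinear ℝ ({A, C, P} : Set (EuclideanSpace ℝ (Fin 2))))
    (hAB : ∃ n : ℤ, dist A B = n) (hAC : ∃ n : ℤ, dist A C = n) (hBC : ∃ n : ℤ, dist B C = n)
    (hPA : ∃ n : ℤ, dist P A = n) (hPB : ∃ n : ℤ, dist P B = n) (hPC : ∃ n : ℤ, dist P C = n)
    (hABd : dist A B ≤ d) (hACd : dist A C ≤ d) :
    dist P A ≤ (4 * d ^ 6 : ℕ) := by
  have strict : ∀ {x y z : EuclideanSpace ℝ (Fin 2)},
      ¬ Collinear ℝ ({x, y, z} : Set (EuclideanSpace ℝ (Fin 2))) →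
      dist x z < dist x y + dist y z ∧ dist x y < dist x z + dist y z ∧
        dist y z < dist x y + dist x z := by
    intro x y z h
    have h1 := dist_lt_dist_add_dist_of_not_collinear_s12 h
    have h2 := dist_lt_dist_add_dist_of_not_collinear_s12 (x := x) (y := z) (z := y)
      (by rwa [Set.pair_comm])
    have h3 := dist_lt_dist_add_dist_of_not_collinear_s12 (x := y) (y := x) (z := z)
      (by rwa [Set.insert_comm])
    rw [dist_comm z y] at h2
    rw [dist_comm y x] at h3
    exact ⟨h1, h2, h3⟩
  obtain ⟨b1, b2, b3⟩ := strict hABC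
  obtain ⟨s1, -, s3⟩ := strict hABP
  obtain ⟨t1, -, t3⟩ := strict hACP
  rw [dist_comm A P, dist_comm B P] at s1 s3
  rw [dist_comm A P, dist_comm C P] at t1 t3
  have hCM : dist P A ^ 2 * (4 * dist A B ^ 2 * dist A C ^ 2
        - (dist A B ^ 2 + dist A C ^ 2 - dist B C ^ 2) ^ 2) =
      dist A C ^ 2 * (dist A B ^ 2 + dist P A ^ 2 - dist P B ^ 2) ^ 2
        - (dist A B ^ 2 + dist A C ^ 2 - dist B C ^ 2)
          * (dist A B ^ 2 + dist P A ^ 2 - dist P B ^ 2)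
          * (dist A C ^ 2 + dist P A ^ 2 - dist P C ^ 2)
        + dist A B ^ 2 * (dist A C ^ 2 + dist P A ^ 2 - dist P C ^ 2) ^ 2 := by
    simp only [EuclideanSpace.dist_sq_eq_fin_two]
    ring
  obtain ⟨b, hb⟩ := hAB
  obtain ⟨c, hc⟩ := hAC
  obtain ⟨a, ha⟩ := hBC
  obtain ⟨r, hr⟩ := hPA
  obtain ⟨s, hs⟩ := hPB
  obtain ⟨t, ht⟩ := hPC
  rw [hr]
  rw [hb] at hABd
  rw [hc] at hACd
  simp only [hb, hc, ha, hr, hs, ht] at b1 b2 b3 s1 s3 t1 t3 hCM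
  norm_cast at hABd hACd b1 b2 b3 s1 s3 t1 t3 hCM
  exact_mod_cast le_of_cayleyMenger_eq_zero hABd hACd (by linarith) (by linarith)
    (by linarith) (by linarith) (by linarith) (by linarith) (by linarith) hCM

theorem eq_of_dist_eq_of_not_collinear {A B C P Q : EuclideanSpace ℝ (Fin 2)}
    (hABC : ¬ Collinear ℝ ({A, B, C} : Set (EuclideanSpace ℝ (Fin 2))))
    (hA : dist P A = dist Q A) (hB : dist P B = dist Q B) (hC : dist P C = dist Q C) :
    P = Q := by
  by_contra hPQ
  have : Fact (Module.finrank ℝ (EuclideanSpace ℝ (Fin 2)) = 1 + 1) := ⟨by simp⟩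
  refine hABC (collinear_iff_finrank_le_one.2 ?_)
  have hsub : ({A, B, C} : Set (EuclideanSpace ℝ (Fin 2))) ⊆ AffineSubspace.perpBisector P Q := by
    simp [Set.insert_subset_iff, AffineSubspace.mem_perpBisector_iff_dist_eq', hA, hB, hC]
  calc Module.finrank ℝ (vectorSpan ℝ {A, B, C})
      ≤ Module.finrank ℝ (AffineSubspace.perpBisector P Q).direction :=
        Submodule.finrank_mono (vectorSpan_mono ℝ hsub)
    _ = 1 := by
      rw [AffineSubspace.direction_perpBisector]
      exact Submodule.finrank_orthogonal_span_singleton (vsub_ne_zero.2 (Ne.symm hPQ))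

theorem exists_level_function (s : ℕ → ℕ) :
    ∃ ℓ : ℕ → ℕ, ∀ n, (ℓ ⁻¹' {n}).Finite ∧ s n < (ℓ ⁻¹' {n}).ncard := by
  obtain ⟨e⟩ : Nonempty (ℕ ≃ Σ n, Fin (s n + 1)) := nonempty_equiv_of_countable
  refine ⟨fun m => (e m).1, fun n => ?_⟩
  have h : (fun m => (e m).1) ⁻¹' {n} = Set.range fun i : Fin (s n + 1) => e.symm ⟨n, i⟩ := by
    ext m
    constructor
    · rintro rfl
      exact ⟨(e m).2, by simp⟩
    · rintro ⟨i, rfl⟩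
      simp
  rw [h]
  refine ⟨Set.finite_range _, ?_⟩
  rw [← Set.image_univ, Set.ncard_image_of_injective, Set.ncard_univ, Nat.card_fin]
  · exact Nat.lt_succ_self _
  · intro i j hij
    simpa using hij

/-- The graph joining distinct vertices whose levels differ by at most one. -/
def levelGraph (ℓ : ℕ → ℕ) : SimpleGraph ℕ where
  Adj u v := u ≠ v ∧ ℓ u ≤ ℓ v + 1 ∧ ℓ v ≤ ℓ u + 1
  symm := ⟨fun _ _ h => ⟨h.1.symm, h.2.2, h.2.1⟩⟩
  loopless := ⟨fun _ h => h.1 rfl⟩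

theorem levelGraph_neighborSet_finite {ℓ : ℕ → ℕ} (h : ∀ n, (ℓ ⁻¹' {n}).Finite) (v : ℕ) :
    ((levelGraph ℓ).neighborSet v).Finite := by
  refine ((Set.finite_Iic (ℓ v + 1)).preimage' fun n _ => h n).subset ?_
  intro u hu
  exact hu.2.2

theorem levelGraph_not_colorable {ℓ : ℕ → ℕ} {n : ℕ} (h : n < (ℓ ⁻¹' {n}).ncard) :
    ¬ (levelGraph ℓ).Colorable n := by
  rintro ⟨c⟩
  refine h.not_ge ?_
  have hinj : Set.InjOn c (ℓ ⁻¹' {n}) := by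
    intro u hu v hv huv
    by_contra hne
    simp only [Set.mem_preimage, Set.mem_singleton_iff] at hu hv
    exact c.valid (show (levelGraph ℓ).Adj u v from ⟨hne, by omega, by omega⟩) huv
  rw [← hinj.ncard_image]
  simpa using Set.ncard_le_card (c '' (ℓ ⁻¹' {n}))

/-- A bound for the diameter of the `n`-th level in an integral realization of a level graph whose
level `0` has diameter at most `d`. -/
def levelDiamBound (d : ℕ) : ℕ → ℕ
  | 0 => d
  | n + 1 => 2 * (4 * levelDiamBound d n ^ 6)

section Realization

variable {ℓ : ℕ → ℕ} {f : ℕ → EuclideanSpace ℝ (Fin 2)}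

theorem IsIntegralRealization.not_collinear (hf : IsIntegralRealization (levelGraph ℓ) f)
    {u v w : ℕ} (huv : u ≠ v) (huw : u ≠ w) (hvw : v ≠ w) :
    ¬ Collinear ℝ ({f u, f v, f w} : Set (EuclideanSpace ℝ (Fin 2))) :=
  hf.2.1 _ _ _ ⟨u, rfl⟩ ⟨v, rfl⟩ ⟨w, rfl⟩ (hf.1.ne huv) (hf.1.ne hvw) (hf.1.ne huw)

theorem IsIntegralRealization.exists_dist_eq (hf : IsIntegralRealization (levelGraph ℓ) f)
    {u v : ℕ} (huv : u ≠ v) (h : ℓ u ≤ ℓ v + 1) (h' : ℓ v ≤ ℓ u + 1) :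
    ∃ n : ℤ, dist (f u) (f v) = n :=
  (hf.2.2 u v huv).1 ⟨huv, h, h'⟩

theorem IsIntegralRealization.dist_le_of_triangle (hf : IsIntegralRealization (levelGraph ℓ) f)
    {n d u v w p : ℕ} (hu : ℓ u = n) (hv : ℓ v = n) (hw : ℓ w = n) (hp : ℓ p = n + 1)
    (huv : u ≠ v) (huw : u ≠ w) (hvw : v ≠ w)
    (hd : ∀ x y, ℓ x = n → ℓ y = n → dist (f x) (f y) ≤ d) :
    dist (f p) (f u) ≤ (4 * d ^ 6 : ℕ) := by
  have hup : u ≠ p := by rintro rfl; omega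
  have hvp : v ≠ p := by rintro rfl; omega
  have hwp : w ≠ p := by rintro rfl; omega
  exact dist_le_of_integral_triangle (hf.not_collinear huv huw hvw)
    (hf.not_collinear huv hup hvp) (hf.not_collinear huw hup hwp)
    (hf.exists_dist_eq huv (by omega) (by omega)) (hf.exists_dist_eq huw (by omega) (by omega))
    (hf.exists_dist_eq hvw (by omega) (by omega))
    (hf.exists_dist_eq hup.symm (by omega) (by omega))
    (hf.exists_dist_eq hvp.symm (by omega) (by omega))
    (hf.exists_dist_eq hwp.symm (by omega) (by omega)) (hd u v hu hv) (hd u w hu hw)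

theorem exists_three_of_level {n : ℕ} (h : 2 < (ℓ ⁻¹' {n}).ncard) :
    ∃ u v w, ℓ u = n ∧ ℓ v = n ∧ ℓ w = n ∧ u ≠ v ∧ u ≠ w ∧ v ≠ w := by
  obtain ⟨u, v, w, hu, hv, hw, huv, huw, hvw⟩ :=
    (Set.two_lt_ncard_iff (Set.finite_of_ncard_pos (by omega))).1 h
  exact ⟨u, v, w, hu, hv, hw, huv, huw, hvw⟩

theorem IsIntegralRealization.dist_le_levelDiamBound
    (hf : IsIntegralRealization (levelGraph ℓ) f) (hℓ : ∀ n, 2 < (ℓ ⁻¹' {n}).ncard) {d : ℕ}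
    (hd : ∀ x y, ℓ x = 0 → ℓ y = 0 → dist (f x) (f y) ≤ d) (n : ℕ) :
    ∀ x y, ℓ x = n → ℓ y = n → dist (f x) (f y) ≤ levelDiamBound d n := by
  induction n with
  | zero => exact hd
  | succ n ih =>
    intro x y hx hy
    obtain ⟨u, v, w, hu, hv, hw, huv, huw, hvw⟩ := exists_three_of_level (hℓ n)
    have h1 := hf.dist_le_of_triangle hu hv hw hx huv huw hvw ih
    have h2 := hf.dist_le_of_triangle hu hv hw hy huv huw hvw ih
    have h3 := dist_triangle_right (f x) (f y) (f u)
    simp only [levelDiamBound]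
    push_cast at h1 h2 ⊢
    linarith

theorem IsIntegralRealization.ncard_level_succ_le
    (hf : IsIntegralRealization (levelGraph ℓ) f) {n d : ℕ} (hℓ : 2 < (ℓ ⁻¹' {n}).ncard)
    (hd : ∀ x y, ℓ x = n → ℓ y = n → dist (f x) (f y) ≤ d) :
    (ℓ ⁻¹' {n + 1}).ncard ≤ (4 * d ^ 6 + 1) ^ 3 := by
  obtain ⟨u, v, w, hu, hv, hw, huv, huw, hvw⟩ := exists_three_of_level hℓ
  let S : Finset ℕ := Finset.range (4 * d ^ 6 + 1)
  let D : ℕ → ℕ → ℕ := fun x p => ⌊dist (f p) (f x)⌋₊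
  have hD : ∀ {x p}, ℓ x = n → ℓ p = n + 1 → (D x p : ℝ) = dist (f p) (f x) := by
    intro x p hx hp
    obtain ⟨m, hm⟩ := hf.exists_dist_eq (u := p) (v := x) (by rintro rfl; omega)
      (by omega) (by omega)
    lift m to ℕ using by exact_mod_cast hm ▸ dist_nonneg
    simp [D, hm]
  have hmem : ∀ {x p}, ℓ x = n → ℓ p = n + 1 → dist (f p) (f x) ≤ (4 * d ^ 6 : ℕ) →
      D x p ∈ S := by
    intro x p hx hp h
    rw [← hD hx hp, Nat.cast_le] at h
    exact Finset.mem_range_succ_iff.2 h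
  have hcard := Set.ncard_le_ncard_of_injOn (s := ℓ ⁻¹' {n + 1})
    (t := (S ×ˢ S ×ˢ S : Finset (ℕ × ℕ × ℕ))) (fun p => (D u p, D v p, D w p))
    (by
      intro p hp
      simp only [SetLike.mem_coe, Finset.mem_product]
      exact ⟨hmem hu hp (hf.dist_le_of_triangle hu hv hw hp huv huw hvw hd),
        hmem hv hp (hf.dist_le_of_triangle hv hu hw hp huv.symm hvw huw hd),
        hmem hw hp (hf.dist_le_of_triangle hw hu hv hp huw.symm hvw.symm huv hd)⟩)
    (by
      intro p hp q hq hpq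
      simp only [Prod.mk.injEq] at hpq
      refine hf.1 (eq_of_dist_eq_of_not_collinear (hf.not_collinear huv huw hvw) ?_ ?_ ?_)
      · rw [← hD hu hp, ← hD hu hq, hpq.1]
      · rw [← hD hv hp, ← hD hv hq, hpq.2.1]
      · rw [← hD hw hp, ← hD hw hq, hpq.2.2])
    (Finset.finite_toSet _)
  rw [Set.ncard_coe_finset, Finset.card_product, Finset.card_product, Finset.card_range] at hcard
  exact hcard.trans_eq (by ring)

end Realization

theorem exists_locally_finite_infinite_chromatic_non_integral_graph :
    ∃ G : SimpleGraph ℕ,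
      (∀ v : ℕ, (G.neighborSet v).Finite) ∧
      (∀ n : ℕ, ¬ G.Colorable n) ∧
      ¬ ∃ f : ℕ → EuclideanSpace ℝ (Fin 2), IsIntegralRealization G f := by
  obtain ⟨ℓ, hℓ⟩ := exists_level_function fun n =>
    n + 2 + (4 * levelDiamBound (n - 1) (n - 1) ^ 6 + 1) ^ 3
  have htwo : ∀ n, 2 < (ℓ ⁻¹' {n}).ncard := fun n => by have := (hℓ n).2; omega
  refine ⟨levelGraph ℓ, levelGraph_neighborSet_finite fun n => (hℓ n).1,
    fun n => levelGraph_not_colorable (by have := (hℓ n).2; omega), ?_⟩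
  rintro ⟨f, hf⟩
  obtain ⟨C, hC⟩ := Metric.isBounded_iff.1 ((hℓ 0).1.image f).isBounded
  obtain ⟨d, hd⟩ := exists_nat_ge C
  have hdiam := hf.dist_le_levelDiamBound htwo (d := d)
    (fun x y hx hy => (hC ⟨x, hx, rfl⟩ ⟨y, hy, rfl⟩).trans hd) d
  have hle := hf.ncard_level_succ_le (htwo d) hdiam
  have hlt := (hℓ (d + 1)).2
  rw [Nat.add_sub_cancel] at hlt
  omega
end

section
/- Let P, Q, R, S be four distinct points in the Euclidean plane ℝ² lying on a common circle. If five of the six pairwise distances among P, Q, R, S are rational, then the sixth pairwise distance is also rational. -/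
theorem exists_eq_mul_cos_two_mul_and_sin {x y r : ℝ} (hr : 0 < r) (h : x ^ 2 + y ^ 2 = r ^ 2) :
    ∃ t : ℝ, x = r * Real.cos (2 * t) ∧ y = r * Real.sin (2 * t) := by
  have hnorm : ‖(⟨x, y⟩ : ℂ)‖ = r := by
    rw [Complex.norm_eq_sqrt_sq_add_sq, h, Real.sqrt_sq hr.le]
  refine ⟨Complex.arg ⟨x, y⟩ / 2, ?_, ?_⟩
  · rw [mul_div_cancel₀ _ two_ne_zero, ← hnorm, Complex.norm_mul_cos_arg]
  · rw [mul_div_cancel₀ _ two_ne_zero, ← hnorm, Complex.norm_mul_sin_arg]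

theorem exists_angle_of_dist_eq {O X : EuclideanSpace ℝ (Fin 2)} {r : ℝ} (hr : 0 < r)
    (h : dist O X = r) :
    ∃ t : ℝ, X 0 = O 0 + r * Real.cos (2 * t) ∧ X 1 = O 1 + r * Real.sin (2 * t) := by
  have hsq : (X 0 - O 0) ^ 2 + (X 1 - O 1) ^ 2 = r ^ 2 := by
    rw [← h, dist_comm, EuclideanSpace.dist_eq, Real.sq_sqrt (by positivity)]
    simp [Fin.sum_univ_two, Real.dist_eq, sq_abs]
  obtain ⟨t, h0, h1⟩ := exists_eq_mul_cos_two_mul_and_sin hr hsq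
  exact ⟨t, by linarith, by linarith⟩

/-- The chord length formula. -/
theorem dist_eq_abs_two_mul_sin_sub {O X Y : EuclideanSpace ℝ (Fin 2)} {r a b : ℝ}
    (hX0 : X 0 = O 0 + r * Real.cos (2 * a)) (hX1 : X 1 = O 1 + r * Real.sin (2 * a))
    (hY0 : Y 0 = O 0 + r * Real.cos (2 * b)) (hY1 : Y 1 = O 1 + r * Real.sin (2 * b)) :
    dist X Y = |2 * r * Real.sin (a - b)| := by
  rw [EuclideanSpace.dist_eq, ← Real.sqrt_sq_eq_abs]
  congr 1
  simp only [Fin.sum_univ_two, Real.dist_eq, sq_abs, hX0, hX1, hY0, hY1]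
  have hcos : Real.cos (2 * a) * Real.cos (2 * b) + Real.sin (2 * a) * Real.sin (2 * b) =
      1 - 2 * Real.sin (a - b) ^ 2 := by
    rw [← Real.cos_sub, ← mul_sub, Real.cos_two_mul, Real.cos_sq']
    ring
  linear_combination r ^ 2 * Real.sin_sq_add_cos_sq (2 * a) +
    r ^ 2 * Real.sin_sq_add_cos_sq (2 * b) - 2 * r ^ 2 * hcos

theorem sin_sub_mul_sin_sub_eq (a b c d : ℝ) :
    Real.sin (a - b) * Real.sin (c - d) =
      Real.sin (a - c) * Real.sin (b - d) - Real.sin (a - d) * Real.sin (b - c) := by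
  simp only [Real.sin_sub]
  ring

theorem exists_rat_of_exists_rat_abs {x : ℝ} (h : ∃ q : ℚ, |x| = (q : ℝ)) :
    ∃ q : ℚ, x = (q : ℝ) := by
  obtain ⟨q, hq⟩ := h
  rcases abs_choice x with hx | hx
  · exact ⟨q, by rw [← hq, hx]⟩
  · exact ⟨-q, by push_cast; linarith⟩


theorem ptolemy_rational (P Q R S : EuclideanSpace ℝ (Fin 2))
    (hPQ : P ≠ Q) (hPR : P ≠ R) (hPS : P ≠ S) (hQR : Q ≠ R) (hQS : Q ≠ S) (hRS : R ≠ S)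
    (O : EuclideanSpace ℝ (Fin 2)) (r : ℝ) (hr : 0 < r)
    (hP : dist O P = r) (hQ : dist O Q = r) (hR : dist O R = r) (hS : dist O S = r)
    (h₁ : ∃ q : ℚ, dist P R = (q : ℝ)) (h₂ : ∃ q : ℚ, dist P S = (q : ℝ))
    (h₃ : ∃ q : ℚ, dist Q R = (q : ℝ)) (h₄ : ∃ q : ℚ, dist Q S = (q : ℝ))
    (h₅ : ∃ q : ℚ, dist R S = (q : ℝ)) :
    ∃ q : ℚ, dist P Q = (q : ℝ) := by
  obtain ⟨a, ha0, ha1⟩ := exists_angle_of_dist_eq hr hP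
  obtain ⟨b, hb0, hb1⟩ := exists_angle_of_dist_eq hr hQ
  obtain ⟨c, hc0, hc1⟩ := exists_angle_of_dist_eq hr hR
  obtain ⟨d, hd0, hd1⟩ := exists_angle_of_dist_eq hr hS
  have hne := dist_ne_zero.mpr hRS
  rw [dist_eq_abs_two_mul_sin_sub hc0 hc1 hd0 hd1] at h₅ hne
  rw [dist_eq_abs_two_mul_sin_sub ha0 ha1 hc0 hc1] at h₁
  rw [dist_eq_abs_two_mul_sin_sub ha0 ha1 hd0 hd1] at h₂
  rw [dist_eq_abs_two_mul_sin_sub hb0 hb1 hc0 hc1] at h₃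
  rw [dist_eq_abs_two_mul_sin_sub hb0 hb1 hd0 hd1] at h₄
  rw [dist_eq_abs_two_mul_sin_sub ha0 ha1 hb0 hb1]
  obtain ⟨q₁, h₁⟩ := exists_rat_of_exists_rat_abs h₁
  obtain ⟨q₂, h₂⟩ := exists_rat_of_exists_rat_abs h₂
  obtain ⟨q₃, h₃⟩ := exists_rat_of_exists_rat_abs h₃
  obtain ⟨q₄, h₄⟩ := exists_rat_of_exists_rat_abs h₄
  obtain ⟨q₅, h₅⟩ := exists_rat_of_exists_rat_abs h₅
  rw [abs_ne_zero, h₅] at hne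
  refine ⟨|(q₁ * q₄ - q₂ * q₃) / q₅|, ?_⟩
  push_cast
  congr 1
  rw [eq_div_iff hne, ← h₁, ← h₂, ← h₃, ← h₄, ← h₅]
  linear_combination 4 * r ^ 2 * sin_sub_mul_sin_sub_eq a b c d
end

section
/- There exists a set S of points on the unit circle {p ∈ ℝ² : dist(p, 0) = 1} that is dense in the unit circle and such that dist(p, q) is rational for all p, q ∈ S. (In particular, the complete graph on countably many vertices is a rational graph.) -/
open Real

/-- The parametrization `t ↦ exp (4 i arctan t)` of the unit circle. -/
noncomputable def circlePoint (t : ℝ) : EuclideanSpace ℝ (Fin 2) :=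
  !₂[cos (4 * arctan t), sin (4 * arctan t)]

theorem continuous_circlePoint : Continuous circlePoint := by
  refine (PiLp.continuous_toLp 2 _).comp (continuous_pi fun i => ?_)
  have := continuous_arctan
  fin_cases i <;> simp <;> fun_prop

theorem dist_circlePoint_zero (t : ℝ) : dist (circlePoint t) 0 = 1 := by
  simp [circlePoint, EuclideanSpace.norm_eq]

theorem exists_circlePoint_eq {p : EuclideanSpace ℝ (Fin 2)} (hp : dist p 0 = 1) :
    ∃ t, circlePoint t = p := by
  have hz : ‖(⟨p 0, p 1⟩ : ℂ)‖ = 1 := by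
    rw [EuclideanSpace.dist_eq] at hp
    simp only [Fin.sum_univ_two, Real.dist_eq, PiLp.zero_apply, sub_zero, sq_abs] at hp
    rw [Complex.norm_eq_sqrt_sq_add_sq, hp]
  set z : ℂ := ⟨p 0, p 1⟩ with hz_def
  have h1 := Complex.neg_pi_lt_arg z
  have h2 := Complex.arg_le_pi z
  have h3 := Complex.norm_mul_cos_arg z
  have h4 := Complex.norm_mul_sin_arg z
  rw [hz, one_mul] at h3 h4
  refine ⟨tan (z.arg / 4), ?_⟩
  have h : 4 * arctan (tan (z.arg / 4)) = z.arg := by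
    rw [arctan_tan (by linarith [pi_pos]) (by linarith [pi_pos])]
    ring
  ext i
  fin_cases i
  · simpa [circlePoint, h] using h3
  · simpa [circlePoint, h] using h4

theorem cos_two_mul_arctan (t : ℝ) : cos (2 * arctan t) = (1 - t ^ 2) / (1 + t ^ 2) := by
  have : 1 + t ^ 2 ≠ 0 := by positivity
  rw [cos_two_mul, cos_sq_arctan]
  field_simp
  ring

theorem sin_two_mul_arctan (t : ℝ) : sin (2 * arctan t) = 2 * t / (1 + t ^ 2) := by
  have h : sin (arctan t) = t * cos (arctan t) := by
    rw [sin_arctan, cos_arctan]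
    ring
  rw [sin_two_mul, h, show 2 * (t * cos (arctan t)) * cos (arctan t) =
    2 * t * cos (arctan t) ^ 2 by ring, cos_sq_arctan]
  ring

theorem dist_circlePoint (t u : ℝ) :
    dist (circlePoint t) (circlePoint u) = 2 * |sin (2 * arctan t - 2 * arctan u)| := by
  rw [EuclideanSpace.dist_eq, sqrt_eq_iff_eq_sq (by positivity) (by positivity), mul_pow, sq_abs]
  simp only [circlePoint, Fin.sum_univ_two, Real.dist_eq, sq_abs, PiLp.toLp_apply,
    Matrix.cons_val_zero, Matrix.cons_val_one]
  rw [cos_sub_cos, sin_sub_sin,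
    show (4 * arctan t - 4 * arctan u) / 2 = 2 * arctan t - 2 * arctan u by ring]
  linear_combination 4 * sin (2 * arctan t - 2 * arctan u) ^ 2 *
    sin_sq_add_cos_sq ((4 * arctan t + 4 * arctan u) / 2)

theorem exists_rat_dist_circlePoint (a b : ℚ) :
    ∃ r : ℚ, dist (circlePoint a) (circlePoint b) = (r : ℝ) := by
  refine ⟨2 * |2 * a / (1 + a ^ 2) * ((1 - b ^ 2) / (1 + b ^ 2)) -
    (1 - a ^ 2) / (1 + a ^ 2) * (2 * b / (1 + b ^ 2))|, ?_⟩
  rw [dist_circlePoint, sin_sub]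
  simp only [cos_two_mul_arctan, sin_two_mul_arctan]
  push_cast
  rfl

theorem exists_dense_rational_subset_of_unit_circle :
    ∃ S : Set (EuclideanSpace ℝ (Fin 2)),
      S ⊆ {p : EuclideanSpace ℝ (Fin 2) | dist p 0 = 1} ∧
      {p : EuclideanSpace ℝ (Fin 2) | dist p 0 = 1} ⊆ closure S ∧
      ∀ p ∈ S, ∀ q ∈ S, ∃ r : ℚ, dist p q = (r : ℝ) := by
  refine ⟨Set.range fun a : ℚ => circlePoint a, ?_, ?_, ?_⟩
  · rintro _ ⟨a, rfl⟩
    exact dist_circlePoint_zero a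
  · intro p hp
    obtain ⟨t, rfl⟩ := exists_circlePoint_eq hp
    exact continuous_circlePoint.range_subset_closure_image_dense Rat.isDenseEmbedding_coe_real.dense
      |>.trans (by rw [← Set.range_comp]; rfl) ⟨t, rfl⟩
  · rintro _ ⟨a, rfl⟩ _ ⟨b, rfl⟩
    exact exists_rat_dist_circlePoint a b
end
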